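/- arXiv:1410.1380 — 2 statements merged into one kernel-verified Lean document; each statement's English description precedes it below -/
import Mathlib

section
/- Let (G, d_G) be a group with a bi-invariant metric and let (X, d_X) be a metric space. Suppose d' is a metric on the disjoint union G ⊔ X extending both d_G and d_X, such that for every x ∈ X the infimum of d'(g, x) over g ∈ G is strictly positive. Then d' extends to a bi-invariant metric δ on the free product G ∗ F(X), where F(X) is the free group with X as a set of generators: the canonical inclusion of G into G ∗ F(X) and the canonical map sending x ∈ X to the corresponding generator of F(X) inside G ∗ F(X) are together an isometry from (G ⊔ X, d') into (G ∗ F(X), δ). -/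
/-- `d : α → α → ℝ` is a metric on `α`. -/
def IsMetricFun {α : Type*} (d : α → α → ℝ) : Prop :=
  (∀ x y, d x y = 0 ↔ x = y) ∧ (∀ x y, d x y = d y x) ∧
    ∀ x y z, d x z ≤ d x y + d y z

/-- `d` is a bi-invariant metric on the group `G`. -/
def IsBiInvMetric {G : Type*} [Group G] (d : G → G → ℝ) : Prop :=
  IsMetricFun d ∧ (∀ g x y : G, d (g * x) (g * y) = d x y) ∧
    ∀ g x y : G, d (x * g) (y * g) = d x y

/-- The metric of the metric space `G` is bi-invariant with respect to the group structure. -/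
def BiInvariantDist (G : Type*) [Group G] [MetricSpace G] : Prop :=
  ∀ g x y : G, dist (g * x) (g * y) = dist x y ∧ dist (x * g) (y * g) = dist x y

set_option linter.unusedSectionVars false
set_option linter.unusedSimpArgs false

namespace Graev

/-- Letters: elements of `G`, generators and inverse generators. -/
inductive Ltr (G X : Type) where
  | g (a : G) : Ltr G X
  | p (x : X) : Ltr G X
  | n (x : X) : Ltr G X

open Ltr Monoid

variable {G X : Type} [Group G]

/-- Formal inverse of a letter. -/
def inv : Ltr G X → Ltr G X
  | g a => g a⁻¹
  | p x => n x
  | n x => p x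

@[simp] theorem inv_inv (a : Ltr G X) : inv (inv a) = a := by cases a <;> simp [inv]

theorem inv_eq_iff (a b : Ltr G X) : inv a = b ↔ a = inv b := by
  constructor
  · rintro rfl; simp
  · rintro rfl; simp

/-- The letter is an element of `G`. -/
def isG : Ltr G X → Prop
  | g _ => True
  | p _ => False
  | n _ => False

theorem isG_iff (a : Ltr G X) : isG a ↔ ∃ h, a = g h := by cases a <;> simp [isG]

@[simp] theorem isG_g (a : G) : isG (g a : Ltr G X) := trivial

@[simp] theorem isG_inv (a : Ltr G X) : isG (inv a) ↔ isG a := by cases a <;> simp [isG, inv]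

/-- Evaluation of a letter. -/
noncomputable def ev : Ltr G X → Coprod G (FreeGroup X)
  | g a => Coprod.inl a
  | p x => Coprod.inr (FreeGroup.of x)
  | n x => (Coprod.inr (FreeGroup.of x))⁻¹

@[simp] theorem ev_inv (a : Ltr G X) : ev (inv a) = (ev a)⁻¹ := by
  cases a <;> simp [ev, inv]

@[simp] theorem ev_one : ev (g 1 : Ltr G X) = 1 := by simp [ev]

theorem ev_g_mul (a b : G) : ev (g (a * b) : Ltr G X) = ev (g a) * ev (g b) := by simp [ev]

/-- Evaluation of a word. -/
noncomputable def val (l : List (Ltr G X)) : Coprod G (FreeGroup X) := (l.map ev).prod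

@[simp] theorem val_nil : val ([] : List (Ltr G X)) = 1 := rfl
@[simp] theorem val_cons (a : Ltr G X) (l) : val (a :: l) = ev a * val l := by simp [val]
@[simp] theorem val_append (l l' : List (Ltr G X)) : val (l ++ l') = val l * val l' := by
  simp [val]

/-- Formal inverse of a word. -/
def winv (l : List (Ltr G X)) : List (Ltr G X) := (l.map inv).reverse

@[simp] theorem val_winv (l : List (Ltr G X)) : val (winv l) = (val l)⁻¹ := by
  induction l with
  | nil => simp [winv]
  | cons a l ih =>
    have : winv (a :: l) = winv l ++ [inv a] := by simp [winv]
    rw [this]; simp [ih]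

@[simp] theorem winv_winv (l : List (Ltr G X)) : winv (winv l) = l := by
  simp [winv, Function.comp_def]

@[simp] theorem winv_append (l l' : List (Ltr G X)) : winv (l ++ l') = winv l' ++ winv l := by
  simp [winv]

@[simp] theorem winv_cons (a) (l : List (Ltr G X)) : winv (a :: l) = winv l ++ [inv a] := by
  simp [winv]

theorem val_surj (w : Coprod G (FreeGroup X)) : ∃ l, val l = w := by
  induction w using Coprod.induction_on with
  | inl a => exact ⟨[g a], by simp [ev]⟩
  | inr f =>
    induction f using FreeGroup.induction_on with
    | C1 => exact ⟨[], by simp⟩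
    | of x => exact ⟨[p x], by simp [ev]⟩
    | inv_of x _ => exact ⟨[n x], by simp [ev]⟩
    | mul a b ha hb =>
      obtain ⟨l, hl⟩ := ha
      obtain ⟨l', hl'⟩ := hb
      exact ⟨l ++ l', by simp [hl, hl']⟩
  | mul a b ha hb =>
    obtain ⟨l, hl⟩ := ha
    obtain ⟨l', hl'⟩ := hb
    exact ⟨l ++ l', by simp [hl, hl']⟩

/-- Two letters may be adjacent in a reduced word. -/
def Good (a b : Ltr G X) : Prop := ¬ (isG a ∧ isG b) ∧ b ≠ inv a

/-- Reduced words. -/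
def Red : List (Ltr G X) → Prop
  | [] => True
  | [a] => a ≠ g 1
  | a :: b :: l => a ≠ g 1 ∧ Good a b ∧ Red (b :: l)

theorem Red.tail {a : Ltr G X} {l} (h : Red (a :: l)) : Red l := by
  cases l with
  | nil => trivial
  | cons b l => exact h.2.2

theorem Red.ne_one {a : Ltr G X} {l} (h : Red (a :: l)) : a ≠ g 1 := by
  cases l with
  | nil => exact h
  | cons b l => exact h.1

theorem Red.of_append {l l' : List (Ltr G X)} (h : Red (l ++ l')) : Red l' := by
  induction l with
  | nil => exact h
  | cons a l ih => exact ih h.tail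

theorem not_red {l : List (Ltr G X)} (h : ¬ Red l) :
    (∃ P Q, l = P ++ g 1 :: Q) ∨ (∃ P a b Q, l = P ++ g a :: g b :: Q) ∨
      (∃ P x Q, ¬ isG x ∧ l = P ++ x :: inv x :: Q) := by
  induction l with
  | nil => exact absurd trivial h
  | cons a l ih =>
    by_cases hl : Red l
    · by_cases ha : a = g 1
      · exact Or.inl ⟨[], l, by simp [ha]⟩
      cases l with
      | nil => exact absurd ha h
      | cons b l =>
        have hg : ¬ Good a b := fun hg => h ⟨ha, hg, hl⟩
        by_cases hh : isG a ∧ isG b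
        · obtain ⟨h1, h2⟩ := hh
          obtain ⟨u, rfl⟩ := (isG_iff _).1 h1
          obtain ⟨v, rfl⟩ := (isG_iff _).1 h2
          exact Or.inr (Or.inl ⟨[], u, v, l, rfl⟩)
        · have hb : b = inv a := by
            by_contra hb
            exact hg ⟨hh, hb⟩
          subst hb
          refine Or.inr (Or.inr ⟨[], a, l, ?_, rfl⟩)
          intro h1; exact hh ⟨h1, by simpa using h1⟩
    · rcases ih hl with ⟨P, Q, rfl⟩ | ⟨P, u, v, Q, rfl⟩ | ⟨P, x, Q, hx, rfl⟩
      · exact Or.inl ⟨a :: P, Q, rfl⟩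
      · exact Or.inr (Or.inl ⟨a :: P, u, v, Q, rfl⟩)
      · exact Or.inr (Or.inr ⟨a :: P, x, Q, hx, rfl⟩)

theorem exists_red_aux (k : ℕ) : ∀ l : List (Ltr G X), l.length = k →
    ∃ l', Red l' ∧ val l' = val l := by
  induction k using Nat.strong_induction_on with
  | _ k ih =>
    intro l hl
    by_cases h : Red l
    · exact ⟨l, h, rfl⟩
    rcases not_red h with ⟨P, Q, rfl⟩ | ⟨P, u, v, Q, rfl⟩ | ⟨P, x, Q, hx, rfl⟩
    · obtain ⟨l', h1, h2⟩ := ih (P ++ Q).length (by simp at hl ⊢; omega) _ rfl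
      exact ⟨l', h1, by simp [h2]⟩
    · obtain ⟨l', h1, h2⟩ := ih (P ++ g (u * v) :: Q).length (by simp at hl ⊢; omega) _ rfl
      exact ⟨l', h1, by simp [h2, ev_g_mul, mul_assoc]⟩
    · obtain ⟨l', h1, h2⟩ := ih (P ++ Q).length (by simp at hl ⊢; omega) _ rfl
      exact ⟨l', h1, by simp [h2]⟩

theorem exists_red (w : Coprod G (FreeGroup X)) : ∃ l, Red l ∧ val l = w := by
  obtain ⟨l, rfl⟩ := val_surj w
  exact exists_red_aux _ l rfl

/-! ### Uniqueness of reduced words, by an action on normal forms -/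

/-- Normality of a stack. -/
def NStk : List (Ltr G X × G) → Prop
  | [] => True
  | [_] => True
  | a :: b :: l => ¬ (a.2 = 1 ∧ b.1 = inv a.1) ∧ NStk (b :: l)

theorem NStk.tail {a : Ltr G X × G} {l} (h : NStk (a :: l)) : NStk l := by
  cases l with
  | nil => trivial
  | cons b l => exact h.2

/-- Normal states. -/
abbrev NS (G X : Type) [Group G] := {s : G × List (Ltr G X × G) // NStk s.2}

open Classical in
/-- Action of a non-`G` letter on states. -/
noncomputable def act (z : Ltr G X) : G × List (Ltr G X × G) → G × List (Ltr G X × G)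
  | (h, []) => (1, [(z, h)])
  | (h, (e, k) :: s) => if h = 1 ∧ e = inv z then (k, s) else (1, (z, h) :: (e, k) :: s)

theorem act_normal (z : Ltr G X) (s : G × List (Ltr G X × G)) (hs : NStk s.2) :
    NStk (act z s).2 := by
  obtain ⟨h, s⟩ := s
  cases s with
  | nil => simp [act, NStk]
  | cons e s =>
    obtain ⟨e, k⟩ := e
    simp only [act]
    split_ifs with hc
    · exact hs.tail
    · exact ⟨hc, hs⟩

theorem act_inv (z : Ltr G X) (s : G × List (Ltr G X × G)) (hs : NStk s.2) :
    act (inv z) (act z s) = s := by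
  obtain ⟨h, s⟩ := s
  cases s with
  | nil => simp [act]
  | cons e s =>
    obtain ⟨e, k⟩ := e
    by_cases hc : h = 1 ∧ e = inv z
    · simp only [act, if_pos hc]
      obtain ⟨rfl, rfl⟩ := hc
      cases s with
      | nil => simp [act]
      | cons f s =>
        obtain ⟨f, k'⟩ := f
        have h2 := hs.1
        simp only [act]
        rw [if_neg h2]
    · simp only [act, if_neg hc]
      simp

/-- Permutation given by a generator. -/
noncomputable def permX (x : X) : Equiv.Perm (NS G X) where
  toFun s := ⟨act (p x) s.1, act_normal _ _ s.2⟩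
  invFun s := ⟨act (n x) s.1, act_normal _ _ s.2⟩
  left_inv s := Subtype.ext (act_inv (p x) s.1 s.2)
  right_inv s := Subtype.ext (act_inv (n x) s.1 s.2)

/-- Permutations given by `G`. -/
def permG : G →* Equiv.Perm (NS G X) where
  toFun a :=
    { toFun := fun s => ⟨(a * s.1.1, s.1.2), s.2⟩
      invFun := fun s => ⟨(a⁻¹ * s.1.1, s.1.2), s.2⟩
      left_inv := fun s => by simp
      right_inv := fun s => by simp }
  map_one' := by ext s <;> simp
  map_mul' a b := by ext s <;> simp [mul_assoc]

/-- The action of the free product on normal states. -/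
noncomputable def Phi : Coprod G (FreeGroup X) →* Equiv.Perm (NS G X) :=
  Coprod.lift permG (FreeGroup.lift permX)

theorem Phi_g (a : G) (s : NS G X) : (Phi (ev (g a)) s).1 = (a * s.1.1, s.1.2) := by
  simp [Phi, ev, permG]

theorem Phi_x (z : Ltr G X) (hz : ¬ isG z) (s : NS G X) : (Phi (ev z) s).1 = act z s.1 := by
  cases z with
  | g a => simp at hz
  | p x => simp [Phi, ev, permX]
  | n x =>
    simp only [Phi, ev, map_inv, Coprod.lift_apply_inr, FreeGroup.lift_apply_of]
    rfl

open Classical in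
/-- The optional letter. -/
noncomputable def pre (h : G) : List (Ltr G X) := if h = 1 then [] else [g h]

/-- Read a word off a state. -/
noncomputable def rb : G → List (Ltr G X × G) → List (Ltr G X)
  | h, [] => pre h
  | h, (z, k) :: s => pre h ++ z :: rb k s

theorem rb_eq (h : G) (s : List (Ltr G X × G)) : rb h s = pre h ++ rb 1 s := by
  cases s <;> simp [rb, pre]

/-- The start state. -/
def start : NS G X := ⟨(1, []), trivial⟩

theorem rb_val (l : List (Ltr G X)) (hl : Red l) :
    rb (Phi (val l) start).1.1 (Phi (val l) start).1.2 = l := by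
  induction l with
  | nil => simp [start, rb, pre]
  | cons a l ih =>
    have ih := ih hl.tail
    simp only [val_cons, map_mul, Equiv.Perm.mul_apply]
    generalize Phi (val l) start = s at ih
    obtain ⟨⟨h, s⟩, hs⟩ := s
    simp only at ih
    by_cases ha : isG a
    · obtain ⟨u, rfl⟩ := (isG_iff _).1 ha
      rw [Phi_g]
      have hu : u ≠ 1 := fun hu => hl.ne_one (by rw [hu])
      have h1 : h = 1 := by
        by_contra hne
        rw [rb_eq] at ih
        simp only [pre, if_neg hne] at ih
        subst ih
        exact hl.2.1.1 ⟨trivial, trivial⟩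
      subst h1
      simp only [mul_one]
      rw [rb_eq, ih]
      simp [pre, hu]
    · rw [Phi_x a ha]
      cases s with
      | nil => simp only [act, rb] at ih ⊢; rw [ih]; simp [pre]
      | cons e s =>
        obtain ⟨e, k⟩ := e
        have hc : ¬ (h = 1 ∧ e = inv a) := by
          rintro ⟨rfl, rfl⟩
          simp only [rb, pre, if_true, List.nil_append] at ih
          subst ih
          exact hl.2.1.2 rfl
        simp only [act, if_neg hc]
        rw [rb, ih]
        simp [pre]

theorem red_unique {l l' : List (Ltr G X)} (hl : Red l) (hl' : Red l') (h : val l = val l') :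
    l = l' := by
  rw [← rb_val l hl, ← rb_val l' hl', h]

theorem red_val_one {l : List (Ltr G X)} (hl : Red l) (h : val l = 1) : l = [] :=
  red_unique hl trivial (by simpa using h)

/-! ### Partner lemmas -/

theorem red_cons_of_not_isG {q z : Ltr G X} {T} {a : G} (hq : ¬ isG q) (hz : ¬ isG z)
    (hT : Red (z :: T)) (h : ¬ (a = 1 ∧ q = z)) :
    ∃ T', Red (inv q :: T') ∧ val T' = ev (g a) * val (z :: T) := by
  have hq1 : inv q ≠ g 1 := by
    intro h; apply hq; rw [← isG_inv, h]; trivial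
  by_cases ha : a = 1
  · subst ha
    refine ⟨z :: T, ⟨hq1, ⟨fun hh => hz hh.2, ?_⟩, hT⟩, by simp⟩
    simp only [inv_inv]
    exact fun hh => h ⟨rfl, hh.symm⟩
  · refine ⟨g a :: z :: T, ⟨hq1, ⟨?_, ?_⟩, ?_, ⟨fun hh => hz hh.2, ?_⟩, hT⟩, by simp⟩
    · simpa using hq
    · simp only [inv_inv]; rintro rfl; exact hq trivial
    · simpa using ha
    · rintro rfl; exact hz trivial

theorem partnerR_aux (m : ℕ) : ∀ (Q : List (Ltr G X)), Q.length = m →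
    ∀ (a : G) (z : Ltr G X) (T), ¬ isG z → Red (z :: T) → val Q = ev (g a) * val (z :: T) →
    ∃ Q1 Q2, Q = Q1 ++ z :: Q2 ∧ val Q1 = ev (g a) := by
  induction m using Nat.strong_induction_on with
  | _ m ih =>
    intro Q hm a z T hz hT hv
    cases Q with
    | nil =>
      exfalso
      by_cases ha : a = 1
      · subst ha
        have := red_val_one hT (by simpa using hv.symm)
        simp at this
      · have : Red (g a :: z :: T) :=
          ⟨by simpa using ha, ⟨fun hh => hz hh.2, by rintro rfl; exact hz trivial⟩, hT⟩
        have := red_val_one this (by simpa using hv.symm)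
        simp at this
    | cons q Q =>
      simp only [List.length_cons] at hm
      by_cases hq : isG q
      · obtain ⟨u, rfl⟩ := (isG_iff _).1 hq
        obtain ⟨Q1, Q2, rfl, h1⟩ := ih Q.length (by omega) Q rfl (u⁻¹ * a) z T hz hT (by
          rw [ev_g_mul, mul_assoc, ← hv, val_cons, ← mul_assoc, ← ev_g_mul]; simp)
        refine ⟨g u :: Q1, Q2, rfl, ?_⟩
        rw [val_cons, h1, ← ev_g_mul]; simp
      · by_cases hc : a = 1 ∧ q = z
        · obtain ⟨rfl, rfl⟩ := hc
          exact ⟨[], Q, rfl, by simp⟩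
        · obtain ⟨T', hT', hv'⟩ := red_cons_of_not_isG hq hz hT hc
          obtain ⟨Q1, Q2, rfl, h1⟩ := ih Q.length (by omega) Q rfl 1 (inv q) T' (by simpa using hq)
            hT' (by rw [val_cons, hv', ← hv]; simp)
          have hv2 : val Q2 = ev (g a) * val (z :: T) := by
            rw [← hv]; simp [h1]
          obtain ⟨Q3, Q4, rfl, h3⟩ := ih Q2.length (by simp at hm; omega) Q2 rfl a z T hz hT hv2
          exact ⟨q :: Q1 ++ inv q :: Q3, Q4, by simp, by simp [h1, h3]⟩

theorem partnerR {Q : List (Ltr G X)} {z : Ltr G X} {T} (hz : ¬ isG z) (hT : Red (z :: T))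
    (hv : val Q = val (z :: T)) : ∃ Q1 Q2, Q = Q1 ++ z :: Q2 ∧ val Q1 = 1 := by
  obtain ⟨Q1, Q2, h, h'⟩ := partnerR_aux _ Q rfl 1 z T hz hT (by simpa using hv)
  exact ⟨Q1, Q2, h, by simpa using h'⟩

theorem partnerG_aux (m : ℕ) : ∀ (Q : List (Ltr G X)), Q.length = m →
    ∀ (a : G) (T), Red (g a :: T) → val Q = val (g a :: T) →
    ∃ Q1 b Q2, Q = Q1 ++ g b :: Q2 ∧ val Q1 = 1 := by
  induction m using Nat.strong_induction_on with
  | _ m ih =>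
    intro Q hm a T hT hv
    cases Q with
    | nil =>
      have := red_val_one hT (by simpa using hv.symm)
      simp at this
    | cons q Q =>
      simp only [List.length_cons] at hm
      by_cases hq : isG q
      · obtain ⟨u, rfl⟩ := (isG_iff _).1 hq
        exact ⟨[], u, Q, rfl, rfl⟩
      · have hR : Red (inv q :: g a :: T) := by
          refine ⟨?_, ⟨by simpa using hq, ?_⟩, hT⟩
          · intro h; apply hq; rw [← isG_inv, h]; trivial
          · simp only [inv_inv]; rintro rfl; exact hq trivial
        obtain ⟨Q1, Q2, rfl, h1⟩ := partnerR (Q := Q) (by simpa using hq) hR (by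
          rw [val_cons, ← hv]; simp)
        have hv2 : val Q2 = val (g a :: T) := by
          rw [← hv]; simp [h1]
        obtain ⟨Q3, b, Q4, rfl, h3⟩ := ih Q2.length (by simp at hm; omega) Q2 rfl a T hT hv2
        exact ⟨q :: Q1 ++ inv q :: Q3, b, Q4, by simp, by simp [h1, h3]⟩

/-- A non-`G` letter of a trivial word has a partner. -/
theorem partner_x {P Q : List (Ltr G X)} {y : Ltr G X} (hy : ¬ isG y)
    (h : val (P ++ y :: Q) = 1) :
    (∃ Q1 Q2, Q = Q1 ++ inv y :: Q2 ∧ val Q1 = 1) ∨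
      (∃ P1 P2, P = P1 ++ inv y :: P2 ∧ val P2 = 1) := by
  obtain ⟨T, hT, hTv⟩ := exists_red (val Q)
  by_cases hc : ∃ T', T = inv y :: T'
  · obtain ⟨T', rfl⟩ := hc
    exact Or.inl (partnerR (by simpa using hy) hT hTv.symm)
  · have hR : Red (y :: T) := by
      have hy1 : y ≠ g 1 := by rintro rfl; exact hy trivial
      cases T with
      | nil => exact hy1
      | cons t T => exact ⟨hy1, ⟨fun hh => hy hh.1, fun ht => hc ⟨T, by rw [ht]⟩⟩, hT⟩
    obtain ⟨Q1, Q2, h1, h2⟩ := partnerR (Q := winv P) hy hR (by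
      simp only [val_append, val_cons] at h
      rw [val_winv, val_cons, hTv]
      exact (eq_inv_of_mul_eq_one_right h).symm)
    refine Or.inr ⟨winv Q2, winv Q1, ?_, by simp [h2]⟩
    rw [← winv_winv P, h1]; simp

theorem partner_g {P Q : List (Ltr G X)} {a : G} (ha : a ≠ 1)
    (h : val (P ++ g a :: Q) = 1) :
    (∃ Q1 b Q2, Q = Q1 ++ g b :: Q2 ∧ val Q1 = 1) ∨
      (∃ P1 b P2, P = P1 ++ g b :: P2 ∧ val P2 = 1) := by
  obtain ⟨T, hT, hTv⟩ := exists_red (val Q)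
  by_cases hc : ∃ b T', T = g b :: T'
  · obtain ⟨b, T', rfl⟩ := hc
    exact Or.inl (partnerG_aux _ Q rfl b T' hT hTv.symm)
  · have hR : Red (g a :: T) := by
      have hy1 : (g a : Ltr G X) ≠ g 1 := by simpa using ha
      cases T with
      | nil => exact hy1
      | cons t T =>
        have ht : ¬ isG t := by
          intro ht
          obtain ⟨u, rfl⟩ := (isG_iff _).1 ht
          exact hc ⟨u, T, rfl⟩
        exact ⟨hy1, ⟨fun hh => ht hh.2, by rintro rfl; exact ht trivial⟩, hT⟩
    obtain ⟨Q1, b, Q2, h1, h2⟩ := partnerG_aux _ (winv P) rfl a T hR (by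
      simp only [val_append, val_cons] at h
      rw [val_winv, val_cons, hTv]
      exact (eq_inv_of_mul_eq_one_right h).symm)
    refine Or.inr ⟨winv Q2, b⁻¹, winv Q1, ?_, by simp [h2]⟩
    rw [← winv_winv P, h1]; simp [inv]

/-! ### Letter metrics and costs -/

/-- Properties of the metric on letters. -/
structure LM (d : Ltr G X → Ltr G X → ℝ) : Prop where
  self : ∀ a, d a a = 0
  symm : ∀ a b, d a b = d b a
  tri : ∀ a b c, d a c ≤ d a b + d b c
  inv : ∀ a b, d (inv a) (inv b) = d a b
  left : ∀ a b c : G, d (g (a * b)) (g (a * c)) = d (g b) (g c)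
  right : ∀ a b c : G, d (g (b * a)) (g (c * a)) = d (g b) (g c)
  pos : ∀ a b, a ≠ b → 0 < d a b
  away : ∀ a, ¬ isG a → ∃ c, 0 < c ∧ ∀ b, c ≤ d a (g b)

variable {d : Ltr G X → Ltr G X → ℝ}

theorem LM.nonneg (hd : LM d) (a b) : 0 ≤ d a b := by
  by_cases h : a = b
  · rw [h, hd.self]
  · exact (hd.pos _ _ h).le

theorem LM.mul (hd : LM d) (a b a' b' : G) :
    d (g (a * b)) (g (a' * b')) ≤ d (g a) (g a') + d (g b) (g b') := by
  have := hd.tri (g (a * b)) (g (a' * b)) (g (a' * b'))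
  rwa [hd.right, hd.left] at this

/-- Cost of a list of pairs of letters. -/
def cost (d : Ltr G X → Ltr G X → ℝ) (L : List (Ltr G X × Ltr G X)) : ℝ :=
  (L.map fun s => d s.1 s.2).sum

@[simp] theorem cost_nil : cost d [] = 0 := rfl
@[simp] theorem cost_cons (s L) : cost d (s :: L) = d s.1 s.2 + cost d L := by simp [cost]
@[simp] theorem cost_append (L L') : cost d (L ++ L') = cost d L + cost d L' := by simp [cost]

theorem cost_nonneg (hd : LM d) (L) : 0 ≤ cost d L := by
  induction L with
  | nil => simp
  | cons s L ih => rw [cost_cons]; have := hd.nonneg s.1 s.2; linarith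

/-- Weight of a letter. -/
def w1 : Ltr G X → ℕ
  | g _ => 1
  | p _ => 2
  | n _ => 2

theorem w1_le (a : Ltr G X) : w1 a ≤ 2 := by cases a <;> simp [w1]
theorem w1_pos (a : Ltr G X) : 1 ≤ w1 a := by cases a <;> simp [w1]
theorem w1_of {a : Ltr G X} (h : ¬ isG a) : w1 a = 2 := by cases a <;> simp_all [w1, isG]
@[simp] theorem w1_g (a : G) : w1 (g a : Ltr G X) = 1 := rfl

/-- Weight of a list of pairs. -/
def wt (L : List (Ltr G X × Ltr G X)) : ℕ := (L.map fun s => w1 s.1 + w1 s.2).sum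

@[simp] theorem wt_nil : wt ([] : List (Ltr G X × Ltr G X)) = 0 := rfl
@[simp] theorem wt_cons (s) (L : List (Ltr G X × Ltr G X)) :
    wt (s :: L) = w1 s.1 + w1 s.2 + wt L := by simp [wt]
@[simp] theorem wt_append (L L' : List (Ltr G X × Ltr G X)) : wt (L ++ L') = wt L + wt L' := by
  simp [wt]

/-- Value of the first components. -/
noncomputable def va (L : List (Ltr G X × Ltr G X)) := val (L.map Prod.fst)
/-- Value of the second components. -/
noncomputable def vb (L : List (Ltr G X × Ltr G X)) := val (L.map Prod.snd)

@[simp] theorem va_nil : va ([] : List (Ltr G X × Ltr G X)) = 1 := rfl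
@[simp] theorem va_cons (s) (L : List (Ltr G X × Ltr G X)) : va (s :: L) = ev s.1 * va L := by
  simp [va]
@[simp] theorem va_append (L L' : List (Ltr G X × Ltr G X)) : va (L ++ L') = va L * va L' := by
  simp [va]
@[simp] theorem vb_nil : vb ([] : List (Ltr G X × Ltr G X)) = 1 := rfl
@[simp] theorem vb_cons (s) (L : List (Ltr G X × Ltr G X)) : vb (s :: L) = ev s.2 * vb L := by
  simp [vb]
@[simp] theorem vb_append (L L' : List (Ltr G X × Ltr G X)) : vb (L ++ L') = vb L * vb L' := by
  simp [vb]

theorem split_map {α β : Type} {f : α → β} {L : List α} {P Q : List β} {y : β}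
    (h : L.map f = P ++ y :: Q) :
    ∃ P' s Q', L = P' ++ s :: Q' ∧ P'.map f = P ∧ f s = y ∧ Q'.map f = Q := by
  obtain ⟨P', R, rfl, h1, h2⟩ := List.map_eq_append_iff.1 h
  obtain ⟨s, Q', rfl, h3, h4⟩ := List.map_eq_cons_iff.1 h2
  exact ⟨P', s, Q', rfl, h1, h3, h4⟩

theorem split_map2 {α β : Type} {f : α → β} {L : List α} {P Q : List β} {y z : β}
    (h : L.map f = P ++ y :: z :: Q) :
    ∃ P' s t Q', L = P' ++ s :: t :: Q' ∧ P'.map f = P ∧ f s = y ∧ f t = z ∧ Q'.map f = Q := by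
  obtain ⟨P', s, R, rfl, h1, h2, h3⟩ := split_map h
  obtain ⟨t, Q', rfl, h4, h5⟩ := List.map_eq_cons_iff.1 h3
  exact ⟨P', s, t, Q', rfl, h1, h2, h4, h5⟩

/-- Raw partner lemma on lists of pairs: substituting the letter `y` by `c`. -/
theorem subst_x (hd : LM d) {P Q : List (Ltr G X × Ltr G X)} {y : Ltr G X} (c : Ltr G X)
    (hy : ¬ isG y) (h : vb P * (ev y * vb Q) = 1) :
    ∃ P' Q', va P' = va P ∧ va Q' = va Q ∧ vb P' * (ev c * vb Q') = 1 ∧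
      cost d P' + cost d Q' ≤ cost d P + cost d Q + d y c ∧ wt P' + wt Q' ≤ wt P + wt Q ∧
      (∀ P0 s, P = P0 ++ [s] → s.2 ≠ inv y → ∃ P0', P' = P0' ++ [s]) ∧
      (∀ Q0 s, Q = s :: Q0 → s.2 ≠ inv y → ∃ Q0', Q' = s :: Q0') := by
  have hw : w1 (inv c) ≤ w1 (inv y) := by
    rw [w1_of (a := inv y) (by simpa using hy)]; exact w1_le _
  have htri : ∀ a, d a (inv c) ≤ d a (inv y) + d y c := fun a => by
    have := hd.tri a (inv y) (inv c)
    rwa [hd.inv] at this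
  rcases partner_x (P := P.map Prod.snd) (Q := Q.map Prod.snd) hy
    (by simpa [vb] using h) with ⟨Q1, Q2, h1, h2⟩ | ⟨P1, P2, h1, h2⟩
  · obtain ⟨R, s, S, rfl, h3, h4, h5⟩ := split_map h1
    obtain ⟨a, b⟩ := s
    simp only at h4; subst h4
    have h6 : vb R = 1 := by rw [vb, h3, h2]
    refine ⟨P, R ++ (a, inv c) :: S, rfl, by simp, ?_, ?_, ?_, ?_, ?_⟩
    · simpa [h6] using h
    · have := htri a; simp; linarith
    · simp; omega
    · rintro P0 s rfl _; exact ⟨P0, rfl⟩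
    · rintro Q0 s hQ hs
      cases R with
      | nil =>
        simp at hQ
        exact absurd (by rw [← hQ.1]) hs
      | cons r R =>
        simp at hQ
        exact ⟨R ++ (a, inv c) :: S, by simp [hQ.1]⟩
  · obtain ⟨R, s, S, rfl, h3, h4, h5⟩ := split_map h1
    obtain ⟨a, b⟩ := s
    simp only at h4; subst h4
    have h6 : vb S = 1 := by rw [vb, h5, h2]
    refine ⟨R ++ (a, inv c) :: S, Q, by simp, rfl, ?_, ?_, ?_, ?_, ?_⟩
    · simpa [h6, mul_assoc] using h
    · have := htri a; simp; linarith
    · simp; omega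
    · rintro P0 s hP hs
      rcases List.eq_nil_or_concat S with rfl | ⟨S, t, rfl⟩
      · have := List.append_inj' hP rfl
        simp at this
        exact absurd (by rw [← this.2]) hs
      · have hP' : (R ++ (a, inv y) :: S) ++ [t] = P0 ++ [s] := by simpa using hP
        have := List.append_inj' hP' rfl
        simp at this
        exact ⟨R ++ (a, inv c) :: S, by simp [this.2]⟩
    · rintro Q0 s rfl _; exact ⟨Q0, rfl⟩

theorem subst_one (hd : LM d) {P Q : List (Ltr G X × Ltr G X)} {y : Ltr G X}
    (h : vb P * (ev y * vb Q) = 1) :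
    ∃ P' Q', va P' = va P ∧ va Q' = va Q ∧ vb P' * vb Q' = 1 ∧
      cost d P' + cost d Q' ≤ cost d P + cost d Q + d y (g 1) ∧ wt P' + wt Q' ≤ wt P + wt Q := by
  by_cases hy : isG y
  swap
  · obtain ⟨P', Q', h1, h2, h3, h4, h5, -⟩ := subst_x hd (g 1) hy h
    exact ⟨P', Q', h1, h2, by simpa using h3, h4, h5⟩
  obtain ⟨u, rfl⟩ := (isG_iff _).1 hy
  by_cases hu : u = 1
  · subst hu
    exact ⟨P, Q, rfl, rfl, by simpa using h, by simp [hd.self], le_rfl⟩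
  rcases partner_g (P := P.map Prod.snd) (Q := Q.map Prod.snd) hu
    (by simpa [vb] using h) with ⟨Q1, b, Q2, h1, h2⟩ | ⟨P1, b, P2, h1, h2⟩
  · obtain ⟨R, s, S, rfl, h3, h4, h5⟩ := split_map h1
    obtain ⟨a, b⟩ := s
    simp only at h4; subst h4
    have h6 : vb R = 1 := by rw [vb, h3, h2]
    refine ⟨P, R ++ (a, g (u * b)) :: S, rfl, by simp, ?_, ?_, by simp⟩
    · simpa [h6, ev_g_mul, mul_assoc] using h
    · have h7 := hd.tri a (g b) (g (u * b))
      have h8 := hd.right b 1 u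
      rw [one_mul, hd.symm (g 1)] at h8
      simp; linarith
  · obtain ⟨R, s, S, rfl, h3, h4, h5⟩ := split_map h1
    obtain ⟨a, b⟩ := s
    simp only at h4; subst h4
    have h6 : vb S = 1 := by rw [vb, h5, h2]
    refine ⟨R ++ (a, g (b * u)) :: S, Q, by simp, rfl, ?_, ?_, by simp⟩
    · simpa [h6, ev_g_mul, mul_assoc] using h
    · have h7 := hd.tri a (g b) (g (b * u))
      have h8 := hd.left b 1 u
      rw [mul_one, hd.symm (g 1)] at h8
      simp; linarith

theorem reduce_aux (hd : LM d) (m : ℕ) : ∀ L : List (Ltr G X × Ltr G X), wt L = m → vb L = 1 →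
    ∃ L', Red (L'.map Prod.fst) ∧ va L' = va L ∧ vb L' = 1 ∧ cost d L' ≤ cost d L := by
  induction m using Nat.strong_induction_on with
  | _ m ih =>
    intro L hm hL
    -- it suffices to find a smaller list
    suffices hs : Red (L.map Prod.fst) ∨
        ∃ L', wt L' < wt L ∧ va L' = va L ∧ vb L' = 1 ∧ cost d L' ≤ cost d L by
      rcases hs with hs | ⟨L', h1, h2, h3, h4⟩
      · exact ⟨L, hs, rfl, hL, le_rfl⟩
      · obtain ⟨L'', h5, h6, h7, h8⟩ := ih (wt L') (hm ▸ h1) L' rfl h3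
        exact ⟨L'', h5, h6.trans h2, h7, h8.trans h4⟩
    by_cases hred : Red (L.map Prod.fst)
    · exact Or.inl hred
    right
    clear ih hm
    rcases not_red hred with ⟨P, Q, h⟩ | ⟨P, u, v, Q, h⟩ | ⟨P, x, Q, hx, h⟩
    · obtain ⟨P, ⟨a, y⟩, Q, rfl, -, h1, -⟩ := split_map h
      simp only at h1; subst h1
      simp only [vb_append, vb_cons] at hL
      obtain ⟨P', Q', h1, h2, h3, h4, h5⟩ := subst_one hd hL
      refine ⟨P' ++ Q', by simp; omega, by simp [h1, h2], by simpa using h3, ?_⟩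
      rw [hd.symm y] at h4
      simp; linarith
    · obtain ⟨P, ⟨a, y⟩, ⟨b, z⟩, Q, rfl, -, h1, h2, -⟩ := split_map2 h
      simp only at h1 h2; subst h1; subst h2
      by_cases hy : isG y
      · by_cases hz : isG z
        · obtain ⟨y, rfl⟩ := (isG_iff _).1 hy
          obtain ⟨z, rfl⟩ := (isG_iff _).1 hz
          refine ⟨P ++ (g (u * v), g (y * z)) :: Q, by simp, by simp [ev_g_mul, mul_assoc],
            by simpa [ev_g_mul, mul_assoc] using hL, ?_⟩
          have := hd.mul u v y z
          simp; linarith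
        · obtain ⟨P', Q', h1, h2, h3, h4, h5, -⟩ := subst_x hd (P := P ++ [(g u, y)]) (Q := Q)
            (g v) hz (by simpa [mul_assoc] using hL)
          refine ⟨P' ++ (g v, g v) :: Q', ?_, by simp [h1, h2, mul_assoc],
            by simpa [mul_assoc] using h3, ?_⟩
          · have := w1_of hz
            simp at h5 ⊢; omega
          · rw [hd.symm z] at h4
            simp [hd.self] at h4 ⊢; linarith
      · obtain ⟨P', Q', h1, h2, h3, h4, h5, -⟩ := subst_x hd (P := P) (Q := (g v, z) :: Q)
          (g u) hy (by simpa [mul_assoc] using hL)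
        refine ⟨P' ++ (g u, g u) :: Q', ?_, by simp [h1, h2, mul_assoc],
          by simpa [mul_assoc] using h3, ?_⟩
        · have := w1_of hy
          simp at h5 ⊢; omega
        · rw [hd.symm y] at h4
          simp [hd.self] at h4 ⊢; linarith
    · obtain ⟨P, ⟨a, y⟩, ⟨b, z⟩, Q, rfl, -, h1, h2, -⟩ := split_map2 h
      simp only at h1 h2; subst h1; subst h2
      have hx2 := w1_of hx
      have hcost : d y (inv z) ≤ d a y + d (inv a) z := by
        have h1 := hd.tri y a (inv z)
        have h2 := hd.inv (inv a) z
        rw [inv_inv] at h2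
        rw [hd.symm y a, h2] at h1; exact h1
      have hcost' : d z (inv y) ≤ d a y + d (inv a) z := by
        have h2 := hd.inv z (inv y)
        rw [inv_inv, hd.symm] at h2
        linarith
      have := w1_pos y
      have := w1_pos z
      by_cases hyz : z = inv y
      · subst hyz
        refine ⟨P ++ Q, by simp; omega, by simp, by simpa using hL, ?_⟩
        have := hd.nonneg a y
        have := hd.nonneg (inv a) (inv y)
        simp; linarith
      by_cases hz : isG z
      · by_cases hy : isG y
        · obtain ⟨y, rfl⟩ := (isG_iff _).1 hy
          obtain ⟨z, rfl⟩ := (isG_iff _).1 hz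
          refine ⟨P ++ (g y, g y) :: (inv (g y), g z) :: Q, ?_, by simp, by simpa using hL, ?_⟩
          · have := w1_of (a := inv a) (by simpa using hx)
            simp [inv] at this ⊢; omega
          · rw [hd.symm] at hcost'
            simp [hd.self]; linarith
        · obtain ⟨P', Q', h1, h2, h3, h4, h5, -, h6⟩ := subst_x hd (P := P)
            (Q := (inv a, z) :: Q) (inv z) hy (by simpa [mul_assoc] using hL)
          obtain ⟨Q0, rfl⟩ := h6 Q (inv a, z) rfl hyz
          refine ⟨P' ++ Q0, ?_, ?_, ?_, ?_⟩
          · simp at h5 ⊢; omega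
          · simp at h2; simp [h1, h2]
          · simpa using h3
          · simp at h4 ⊢; linarith
      · obtain ⟨P', Q', h1, h2, h3, h4, h5, h6, -⟩ := subst_x hd (P := P ++ [(a, y)])
            (Q := Q) (inv y) hz (by simpa [mul_assoc] using hL)
        obtain ⟨P0, rfl⟩ := h6 P (a, y) rfl (fun h => hyz (by
          simp only at h; rw [h, inv_inv]))
        refine ⟨P0 ++ Q', ?_, ?_, ?_, ?_⟩
        · simp at h5 ⊢; omega
        · simp at h1; simp [h1, h2]
        · simpa [mul_assoc] using h3
        · simp at h4 ⊢; linarith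

theorem reduce (hd : LM d) {R : List (Ltr G X)} (hR : Red R) (L : List (Ltr G X × Ltr G X))
    (ha : va L = val R) (hb : vb L = 1) :
    ∃ L', L'.map Prod.fst = R ∧ vb L' = 1 ∧ cost d L' ≤ cost d L := by
  obtain ⟨L', h1, h2, h3, h4⟩ := reduce_aux hd _ L rfl hb
  exact ⟨L', red_unique h1 hR (by rw [← ha, ← h2, va]), h3, h4⟩

theorem exists_low {α : Type} (f : α → ℝ) (l : List α) :
    ∃ r, 0 < r ∧ ∀ a ∈ l, 0 < f a → r ≤ f a := by
  induction l with
  | nil => exact ⟨1, one_pos, by simp⟩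
  | cons b l ih =>
    obtain ⟨r, hr, h⟩ := ih
    by_cases hb : 0 < f b
    · refine ⟨min r (f b), lt_min hr hb, fun a ha h0 => ?_⟩
      rcases List.mem_cons.1 ha with rfl | ha
      · exact min_le_right _ _
      · exact (min_le_left _ _).trans (h a ha h0)
    · refine ⟨r, hr, fun a ha h0 => ?_⟩
      rcases List.mem_cons.1 ha with rfl | ha
      · exact absurd h0 hb
      · exact h a ha h0

theorem low (hd : LM d) {R : List (Ltr G X)} (hR : Red R) (hne : R ≠ []) :
    ∃ r, 0 < r ∧ ∀ L : List (Ltr G X × Ltr G X), va L = val R → vb L = 1 → r ≤ cost d L := by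
  classical
  have hc : ∃ c : Ltr G X → ℝ, ∀ a, 0 < c a ∧ (¬ isG a → ∀ b, c a ≤ d a (g b)) := by
    have : ∀ a : Ltr G X, ∃ c : ℝ, 0 < c ∧ (¬ isG a → ∀ b, c ≤ d a (g b)) := fun a => by
      by_cases ha : isG a
      · exact ⟨1, one_pos, fun h => absurd ha h⟩
      · obtain ⟨c, h1, h2⟩ := hd.away a ha
        exact ⟨c, h1, fun _ => h2⟩
    choose c hc using this
    exact ⟨c, hc⟩
  obtain ⟨c, hc⟩ := hc
  obtain ⟨r1, hr1, h1⟩ := exists_low c R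
  obtain ⟨r2, hr2, h2⟩ := exists_low (fun a => d a (g 1)) R
  obtain ⟨r3, hr3, h3⟩ := exists_low (fun s : Ltr G X × Ltr G X => d s.1 (inv s.2)) (R ×ˢ R)
  refine ⟨min r1 (min r2 r3), by positivity, fun L ha hb => ?_⟩
  obtain ⟨L', hL', hb', hle⟩ := reduce hd hR L ha hb
  refine le_trans ?_ hle
  have hnr : ¬ Red (L'.map Prod.snd) := fun h => by
    have h := red_val_one h hb'
    simp at h
    subst h
    exact hne hL'.symm
  have m1 : min r1 (min r2 r3) ≤ r1 := min_le_left _ _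
  have m2 : min r1 (min r2 r3) ≤ r2 := (min_le_right _ _).trans (min_le_left _ _)
  have m3 : min r1 (min r2 r3) ≤ r3 := (min_le_right _ _).trans (min_le_right _ _)
  rcases not_red hnr with ⟨P, Q, h⟩ | ⟨P, u, v, Q, h⟩ | ⟨P, x, Q, hx, h⟩
  · obtain ⟨P, ⟨a, y⟩, Q, rfl, -, h4, -⟩ := split_map h
    simp only at h4; subst h4
    subst hL'
    have ha1 : a ≠ g 1 := by
      simp only [List.map_append, List.map_cons] at hR
      exact hR.of_append.ne_one
    have := h2 a (by simp) (hd.pos _ _ ha1)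
    have := cost_nonneg hd P
    have := cost_nonneg hd Q
    simp only [cost_append, cost_cons]; linarith
  · obtain ⟨P, ⟨a, y⟩, ⟨b, z⟩, Q, rfl, -, h4, h5, -⟩ := split_map2 h
    simp only at h4 h5; subst h4; subst h5
    subst hL'
    have hg : Good a b := by
      simp only [List.map_append, List.map_cons] at hR
      exact hR.of_append.2.1
    have := cost_nonneg hd P
    have := cost_nonneg hd Q
    have := hd.nonneg a (g u)
    have := hd.nonneg b (g v)
    simp only [cost_append, cost_cons]
    by_cases ha : isG a
    · have hb : ¬ isG b := fun hb => hg.1 ⟨ha, hb⟩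
      have := h1 b (by simp) (hc b).1
      have := (hc b).2 hb v
      linarith
    · have := h1 a (by simp) (hc a).1
      have := (hc a).2 ha u
      linarith
  · obtain ⟨P, ⟨a, y⟩, ⟨b, z⟩, Q, rfl, -, h4, h5, -⟩ := split_map2 h
    simp only at h4 h5; subst h4; subst h5
    subst hL'
    have hg : Good a b := by
      simp only [List.map_append, List.map_cons] at hR
      exact hR.of_append.2.1
    have hab : a ≠ inv b := fun h => hg.2 (by rw [h, inv_inv])
    have := cost_nonneg hd P
    have := cost_nonneg hd Q
    have := h3 (a, b) (by simp) (hd.pos _ _ hab)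
    have h6 := hd.tri a y (inv b)
    have h7 := hd.inv b (inv y)
    rw [inv_inv, hd.symm] at h7
    simp only [cost_append, cost_cons] at *; linarith

theorem low_one (hd : LM d) {p : Ltr G X} (hR : p ≠ g 1) (L : List (Ltr G X × Ltr G X))
    (ha : va L = ev p) (hb : vb L = 1) : d p (g 1) ≤ cost d L := by
  obtain ⟨L', hL', hb', hle⟩ := reduce hd (R := [p]) hR L (by simpa using ha) hb
  refine le_trans ?_ hle
  obtain ⟨⟨a, b⟩, L'', rfl, h1, h2⟩ := List.map_eq_cons_iff.1 hL'
  simp at h1 h2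
  subst h1; subst h2
  have : b = g 1 := by
    by_contra h
    have := red_val_one (l := [b]) h (by simpa using hb')
    simp at this
  subst this
  simp

theorem ev_inj {a b : Ltr G X} (h : ev a = ev b) : a = b := by
  by_cases ha : a = g 1
  · by_contra hb
    have hb1 : b ≠ g 1 := fun h => hb (ha.trans h.symm)
    have := red_val_one (l := [b]) hb1 (by simp [← h, ha])
    simp at this
  · by_cases hb : b = g 1
    · have := red_val_one (l := [a]) ha (by simp [h, hb])
      simp at this
    · have := red_unique (l := [a]) (l' := [b]) ha hb (by simp [h])
      simpa using this

theorem low_two (hd : LM d) {p q : Ltr G X} (hR : Red [p, q]) (L : List (Ltr G X × Ltr G X))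
    (ha : va L = ev p * ev q) (hb : vb L = 1) : d p (inv q) ≤ cost d L := by
  obtain ⟨L', hL', hb', hle⟩ := reduce hd hR L (by simpa using ha) hb
  refine le_trans ?_ hle
  obtain ⟨⟨a, b⟩, L'', rfl, h1, h2⟩ := List.map_eq_cons_iff.1 hL'
  obtain ⟨⟨a', b'⟩, L'', rfl, h3, h4⟩ := List.map_eq_cons_iff.1 h2
  simp at h1 h3 h4
  subst h1; subst h3; subst h4
  have : b' = inv b := by
    apply ev_inj
    rw [ev_inv]
    exact eq_inv_of_mul_eq_one_right (by simpa using hb')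
  subst this
  have h6 := hd.tri a b (inv a')
  have h7 := hd.inv a' (inv b)
  rw [inv_inv, hd.symm] at h7
  simp; linarith

/-- The isometry lower bound. -/
theorem low_iso (hd : LM d) (u v : Ltr G X) (L : List (Ltr G X × Ltr G X))
    (ha : va L = (ev u)⁻¹ * ev v) (hb : vb L = 1) : d u v ≤ cost d L := by
  by_cases huv : u = v
  · subst huv; rw [hd.self]; exact cost_nonneg hd L
  by_cases hu : u = g 1
  · subst hu
    rw [hd.symm]
    exact low_one hd (fun h => huv h.symm) L (by simpa using ha) hb
  by_cases hv : v = g 1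
  · subst hv
    have h1 : (inv (g 1) : Ltr G X) = g 1 := by simp [inv]
    have := hd.inv u (g 1)
    rw [h1] at this
    rw [← this]
    refine low_one hd (fun h => huv ?_) L (by simpa using ha) hb
    rw [inv_eq_iff] at h; rw [h, h1]
  by_cases hg : isG u ∧ isG v
  · obtain ⟨h1, h2⟩ := hg
    obtain ⟨u, rfl⟩ := (isG_iff _).1 h1
    obtain ⟨v, rfl⟩ := (isG_iff _).1 h2
    have h3 := hd.left u⁻¹ v u
    rw [inv_mul_cancel] at h3
    rw [hd.symm, ← h3]
    refine low_one hd ?_ L (by rw [ha, ev_g_mul]; simp [ev]) hb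
    intro h
    apply huv
    simp only [Ltr.g.injEq] at h ⊢
    exact inv_mul_eq_one.1 h
  · have h1 : (inv (g 1) : Ltr G X) = g 1 := by simp [inv]
    have := low_two hd (p := inv u) (q := v) ⟨fun h => hu (by rw [inv_eq_iff] at h; rw [h, h1]),
      ⟨by simpa using hg, by simpa using fun h => huv h.symm⟩, hv⟩ L (by simpa using ha) hb
    rwa [hd.inv] at this

/-! ### The norm -/

/-- Costs of representations of `w`. -/
def Costs (d : Ltr G X → Ltr G X → ℝ) (w : Coprod G (FreeGroup X)) : Set ℝ :=
  {r | ∃ L, va L = w ∧ vb L = 1 ∧ cost d L = r}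

/-- The Graev norm. -/
noncomputable def nrm (d : Ltr G X → Ltr G X → ℝ) (w : Coprod G (FreeGroup X)) : ℝ :=
  sInf (Costs d w)

theorem nrm_le (hd : LM d) (L : List (Ltr G X × Ltr G X)) (hb : vb L = 1) :
    nrm d (va L) ≤ cost d L := by
  refine csInf_le ⟨0, ?_⟩ ⟨L, rfl, hb, rfl⟩
  rintro r ⟨L, -, -, rfl⟩
  exact cost_nonneg hd L

/-- Diagonal list. -/
def dia (l : List (Ltr G X)) : List (Ltr G X × Ltr G X) := l.map fun a => (a, a)

@[simp] theorem va_dia (l : List (Ltr G X)) : va (dia l) = val l := by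
  simp [va, dia, Function.comp_def]
@[simp] theorem vb_dia (l : List (Ltr G X)) : vb (dia l) = val l := by
  simp [vb, dia, Function.comp_def]
theorem cost_dia (hd : LM d) (l : List (Ltr G X)) : cost d (dia l) = 0 := by
  induction l with
  | nil => rfl
  | cons a l ih =>
    have : dia (a :: l) = (a, a) :: dia l := rfl
    rw [this, cost_cons, ih, hd.self, add_zero]

theorem costs_ne (w : Coprod G (FreeGroup X)) : (Costs d w).Nonempty := by
  obtain ⟨l, rfl⟩ := val_surj w
  exact ⟨_, l.map fun a => (a, g 1), by simp [va, Function.comp_def], by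
    induction l with
    | nil => rfl
    | cons a l ih => simp at ih ⊢; exact ih, rfl⟩

theorem le_nrm {w : Coprod G (FreeGroup X)} {r : ℝ}
    (h : ∀ L, va L = w → vb L = 1 → r ≤ cost d L) : r ≤ nrm d w := by
  refine le_csInf (costs_ne w) ?_
  rintro _ ⟨L, h1, h2, rfl⟩
  exact h L h1 h2

theorem nrm_nonneg (hd : LM d) (w) : 0 ≤ nrm d w := le_nrm fun L _ _ => cost_nonneg hd L

theorem nrm_one (hd : LM d) : nrm d 1 = 0 :=
  le_antisymm (by simpa using nrm_le hd [] rfl) (nrm_nonneg hd 1)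

theorem nrm_eq_zero (hd : LM d) {w} (h : nrm d w = 0) : w = 1 := by
  by_contra hw
  obtain ⟨R, hR, rfl⟩ := exists_red w
  obtain ⟨r, hr, h1⟩ := low hd hR (by rintro rfl; exact hw rfl)
  have := le_nrm h1
  linarith

theorem nrm_inv_le (hd : LM d) (w) : nrm d w⁻¹ ≤ nrm d w := by
  refine le_nrm ?_
  rintro L rfl hb
  have key : ∀ L : List (Ltr G X × Ltr G X), ∃ L', va L' = (va L)⁻¹ ∧ vb L' = (vb L)⁻¹ ∧
      cost d L' = cost d L := by
    intro L
    induction L with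
    | nil => exact ⟨[], by simp, by simp, rfl⟩
    | cons s L ih =>
      obtain ⟨L', h1, h2, h3⟩ := ih
      exact ⟨L' ++ [(inv s.1, inv s.2)], by simp [h1], by simp [h2], by
        simp [h3, hd.inv, add_comm]⟩
  obtain ⟨L', h1, h2, h3⟩ := key L
  rw [← h1, ← h3]
  exact nrm_le hd _ (by simp [h2, hb])

theorem nrm_inv (hd : LM d) (w) : nrm d w⁻¹ = nrm d w :=
  le_antisymm (nrm_inv_le hd w) (by simpa using nrm_inv_le hd w⁻¹)

theorem nrm_conj_le (hd : LM d) (u w) : nrm d (u * w * u⁻¹) ≤ nrm d w := by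
  refine le_nrm ?_
  rintro L rfl hb
  obtain ⟨l, rfl⟩ := val_surj u
  have := nrm_le hd (dia l ++ L ++ dia (winv l)) (by simp [hb])
  simpa [cost_dia hd, mul_assoc] using this

theorem nrm_conj (hd : LM d) (u w) : nrm d (u * w * u⁻¹) = nrm d w := by
  refine le_antisymm (nrm_conj_le hd u w) ?_
  have := nrm_conj_le hd u⁻¹ (u * w * u⁻¹)
  simpa [mul_assoc] using this

theorem nrm_mul (hd : LM d) (u w) : nrm d (u * w) ≤ nrm d u + nrm d w := by
  have : nrm d (u * w) - nrm d w ≤ nrm d u := by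
    refine le_nrm ?_
    rintro L rfl hb
    have : nrm d (va L * w) - cost d L ≤ nrm d w := by
      refine le_nrm ?_
      rintro L' rfl hb'
      have := nrm_le hd (L ++ L') (by simp [hb, hb'])
      simp at this; linarith
    linarith
  linarith

theorem nrm_iso (hd : LM d) (u v : Ltr G X) : nrm d ((ev u)⁻¹ * ev v) = d u v := by
  apply le_antisymm
  · have := nrm_le hd [(inv u, inv u), (v, u)] (by simp)
    rw [hd.symm u v]
    simpa [hd.self] using this
  · exact le_nrm fun L ha hb => low_iso hd u v L ha hb

theorem main_of_LM (hd : LM d) : ∃ _ : MetricSpace (Coprod G (FreeGroup X)),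
    BiInvariantDist (Coprod G (FreeGroup X)) ∧ ∀ u v : Ltr G X, dist (ev u) (ev v) = d u v := by
  let M : MetricSpace (Coprod G (FreeGroup X)) :=
    { dist := fun u v => nrm d (u⁻¹ * v)
      dist_self := fun u => by simp [nrm_one hd]
      dist_comm := fun u v => by
        rw [← nrm_inv hd]; simp
      dist_triangle := fun u v w => by
        have := nrm_mul hd (u⁻¹ * v) (v⁻¹ * w)
        simpa [mul_assoc] using this
      eq_of_dist_eq_zero := fun {u v} h => inv_mul_eq_one.1 (nrm_eq_zero hd h) }
  refine ⟨M, fun a x y => ⟨?_, ?_⟩, fun u v => nrm_iso hd u v⟩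
  · change nrm d _ = nrm d _
    simp [mul_assoc]
  · change nrm d _ = nrm d _
    have := nrm_conj hd a⁻¹ (x⁻¹ * y)
    simpa [mul_assoc] using this

/-! ### The letter metric extending the given one -/

section extend

variable (d' : G ⊕ X → G ⊕ X → ℝ)

/-- Distance across. -/
noncomputable def cross (u : G ⊕ X) (y : X) : ℝ :=
  ⨅ a : G, (d' u (Sum.inl a) + d' (Sum.inl a⁻¹) (Sum.inr y))

/-- Letters which are not inverse generators live in `G ⊕ X`, the others in `X`. -/
def side : Ltr G X → (G ⊕ X) ⊕ X
  | g a => Sum.inl (Sum.inl a)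
  | p x => Sum.inl (Sum.inr x)
  | n x => Sum.inr x

/-- The metric on letters, in terms of sides. -/
noncomputable def sd : (G ⊕ X) ⊕ X → (G ⊕ X) ⊕ X → ℝ
  | Sum.inl u, Sum.inl v => d' u v
  | Sum.inl u, Sum.inr y => cross d' u y
  | Sum.inr y, Sum.inl u => cross d' u y
  | Sum.inr x, Sum.inr y => d' (Sum.inr x) (Sum.inr y)

variable {d'}

theorem nn_of_metric (h : IsMetricFun d') (u v) : 0 ≤ d' u v := by
  have h1 := h.2.2 u v u
  rw [(h.1 u u).2 rfl, h.2.1 v u] at h1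
  linarith

theorem cross_le (h : IsMetricFun d') (u : G ⊕ X) (y : X) (a : G) :
    cross d' u y ≤ d' u (Sum.inl a) + d' (Sum.inl a⁻¹) (Sum.inr y) := by
  refine ciInf_le ⟨0, ?_⟩ a
  rintro _ ⟨a, rfl⟩
  exact add_nonneg (nn_of_metric h _ _) (nn_of_metric h _ _)

theorem le_cross {u : G ⊕ X} {y : X} {r : ℝ}
    (hr : ∀ a, r ≤ d' u (Sum.inl a) + d' (Sum.inl a⁻¹) (Sum.inr y)) : r ≤ cross d' u y :=
  le_ciInf hr

theorem inv_dist (h : IsMetricFun d')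
    (hl : ∀ a b c : G, d' (Sum.inl (a * b)) (Sum.inl (a * c)) = d' (Sum.inl b) (Sum.inl c))
    (hr : ∀ a b c : G, d' (Sum.inl (b * a)) (Sum.inl (c * a)) = d' (Sum.inl b) (Sum.inl c))
    (a b : G) : d' (Sum.inl a⁻¹) (Sum.inl b⁻¹) = d' (Sum.inl a) (Sum.inl b) := by
  have h1 := hl a a⁻¹ b⁻¹
  have h2 := hr b (a * a⁻¹) (a * b⁻¹)
  rw [← h1, ← h2]
  simp [h.2.1]

theorem cross_tri (h : IsMetricFun d') (u v : G ⊕ X) (y : X) :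
    cross d' u y ≤ d' u v + cross d' v y := by
  have : cross d' u y - d' u v ≤ cross d' v y := le_cross fun a => by
    have h1 := cross_le h u y a
    have h2 := h.2.2 u v (Sum.inl a)
    linarith
  linarith

theorem cross_tri' (h : IsMetricFun d') (u : G ⊕ X) (x y : X) :
    cross d' u y ≤ cross d' u x + d' (Sum.inr x) (Sum.inr y) := by
  have : cross d' u y - d' (Sum.inr x) (Sum.inr y) ≤ cross d' u x := le_cross fun a => by
    have h1 := cross_le h u y a
    have h2 := h.2.2 (Sum.inl a⁻¹) (Sum.inr x) (Sum.inr y)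
    linarith
  linarith

theorem cross_g (h : IsMetricFun d')
    (hi : ∀ a b : G, d' (Sum.inl a⁻¹) (Sum.inl b⁻¹) = d' (Sum.inl a) (Sum.inl b))
    (a : G) (y : X) : cross d' (Sum.inl a) y = d' (Sum.inl a⁻¹) (Sum.inr y) := by
  apply le_antisymm
  · have := cross_le h (Sum.inl a) y a
    rwa [(h.1 _ _).2 rfl, zero_add] at this
  · refine le_cross fun b => ?_
    rw [← hi]
    exact h.2.2 _ _ _

theorem cross_tri2 (h : IsMetricFun d')
    (hi : ∀ a b : G, d' (Sum.inl a⁻¹) (Sum.inl b⁻¹) = d' (Sum.inl a) (Sum.inl b))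
    (u v : G ⊕ X) (y : X) : d' u v ≤ cross d' u y + cross d' v y := by
  have : d' u v - cross d' v y ≤ cross d' u y := le_cross fun a => by
    have : d' u v - (d' u (Sum.inl a) + d' (Sum.inl a⁻¹) (Sum.inr y)) ≤ cross d' v y :=
      le_cross fun b => by
        have h1 := h.2.2 u (Sum.inl a) v
        have h2 := h.2.2 (Sum.inl a) (Sum.inl b) v
        have h3 := h.2.2 (Sum.inl a⁻¹) (Sum.inr y) (Sum.inl b⁻¹)
        rw [hi] at h3
        rw [h.2.1 v, h.2.1 (Sum.inl b⁻¹)]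
        linarith
    linarith
  linarith

theorem cross_symm (h : IsMetricFun d') (x y : X) :
    cross d' (Sum.inr x) y = cross d' (Sum.inr y) x := by
  have : ∀ x y, cross d' (Sum.inr x) y ≤ cross d' (Sum.inr y) x := fun x y =>
    le_cross fun a => by
      have := cross_le h (Sum.inr x) y a⁻¹
      rw [_root_.inv_inv, h.2.1 (Sum.inr x), h.2.1 (Sum.inl a)] at this
      linarith
  exact le_antisymm (this _ _) (this _ _)

theorem cross_tri3 (h : IsMetricFun d')
    (hi : ∀ a b : G, d' (Sum.inl a⁻¹) (Sum.inl b⁻¹) = d' (Sum.inl a) (Sum.inl b))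
    (u : G ⊕ X) (x y : X) :
    d' (Sum.inr x) (Sum.inr y) ≤ cross d' u x + cross d' u y := by
  have : d' (Sum.inr x) (Sum.inr y) - cross d' u y ≤ cross d' u x := le_cross fun a => by
    have : d' (Sum.inr x) (Sum.inr y) - (d' u (Sum.inl a) + d' (Sum.inl a⁻¹) (Sum.inr x)) ≤
        cross d' u y :=
      le_cross fun b => by
        have h1 := h.2.2 (Sum.inr x) (Sum.inl a⁻¹) (Sum.inr y)
        have h2 := h.2.2 (Sum.inl a⁻¹) (Sum.inl b⁻¹) (Sum.inr y)
        have h3 := h.2.2 (Sum.inl a) u (Sum.inl b)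
        rw [hi] at h2
        rw [h.2.1 (Sum.inr x) (Sum.inl a⁻¹)] at h1
        rw [h.2.1 (Sum.inl a) u] at h3
        linarith
    linarith
  linarith

theorem LM_sd (h : IsMetricFun d')
    (hl : ∀ a b c : G, d' (Sum.inl (a * b)) (Sum.inl (a * c)) = d' (Sum.inl b) (Sum.inl c))
    (hr : ∀ a b c : G, d' (Sum.inl (b * a)) (Sum.inl (c * a)) = d' (Sum.inl b) (Sum.inl c))
    (hpos : ∀ x : X, ∃ c : ℝ, 0 < c ∧ ∀ a : G, c ≤ d' (Sum.inl a) (Sum.inr x)) :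
    LM (fun a b : Ltr G X => sd d' (side a) (side b)) := by
  have hi := inv_dist h hl hr
  have hp : ∀ u v, u ≠ v → 0 < d' u v := fun u v huv =>
    lt_of_le_of_ne (nn_of_metric h u v) (fun h0 => huv ((h.1 u v).1 h0.symm))
  have hcp : ∀ u y, 0 < cross d' u y := fun u y => by
    obtain ⟨c, hc, hc'⟩ := hpos y
    refine lt_of_lt_of_le hc (le_cross fun a => ?_)
    have := nn_of_metric h u (Sum.inl a)
    have := hc' a⁻¹
    linarith
  have hs : ∀ a b, sd d' a b = sd d' b a := by
    rintro (u | x) (v | y)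
    · exact h.2.1 _ _
    · rfl
    · rfl
    · exact h.2.1 _ _
  refine ⟨?_, fun a b => hs _ _, ?_, ?_, ?_, ?_, ?_, ?_⟩
  · intro a
    cases a <;> exact (h.1 _ _).2 rfl
  · intro a b c
    generalize side a = a
    generalize side b = b
    generalize side c = c
    obtain a | a := a <;> obtain b | b := b <;> obtain c | c := c <;> simp only [sd]
    · exact h.2.2 _ _ _
    · exact cross_tri h _ _ _
    · exact cross_tri2 h hi _ _ _
    · exact cross_tri' h _ _ _
    · have := cross_tri h c b a
      rw [h.2.1] at this; linarith
    · exact cross_tri3 h hi _ _ _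
    · have := cross_tri' h c b a
      rw [h.2.1] at this; linarith
    · exact h.2.2 _ _ _
  · intro a b
    cases a <;> cases b <;> simp [inv, side, sd, cross_g h hi, hi, h.2.1, cross_symm h]
  · exact hl
  · exact hr
  · intro a b hab
    cases a <;> cases b <;> simp only [side, sd] <;> first | exact hcp _ _ | (apply hp; simp_all)
  · intro a ha
    cases a with
    | g a => exact absurd trivial ha
    | p x =>
      obtain ⟨c, hc, hc'⟩ := hpos x
      exact ⟨c, hc, fun b => by simpa [side, sd, h.2.1] using hc' b⟩
    | n x =>
      obtain ⟨c, hc, hc'⟩ := hpos x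
      exact ⟨c, hc, fun b => by simpa [side, sd, cross_g h hi] using hc' b⁻¹⟩

end extend

end Graev

/-- **Graev-type extension.** Let `G` be a group with bi-invariant metric and
`X` a metric space, and let `d'` be a metric on the disjoint union `G ⊕ X` extending both
metrics and keeping `X` at positive distance from `G`.  Then `d'` extends to a bi-invariant
metric on the free product `G ∗ F(X)`: there is a bi-invariant metric on `G ∗ F(X)` such that
the canonical map `G ⊕ X → G ∗ F(X)` is an isometry w.r.t. `d'`. -/
theorem graev_extension (G X : Type) [Group G] [MetricSpace G] [MetricSpace X]
    (hbi : BiInvariantDist G)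
    (d' : G ⊕ X → G ⊕ X → ℝ) (hd' : IsMetricFun d')
    (hdG : ∀ g g' : G, d' (Sum.inl g) (Sum.inl g') = dist g g')
    (hdX : ∀ x x' : X, d' (Sum.inr x) (Sum.inr x') = dist x x')
    (hpos : ∀ x : X, ∃ c : ℝ, 0 < c ∧ ∀ g : G, c ≤ d' (Sum.inl g) (Sum.inr x)) :
    ∃ _ : MetricSpace (Monoid.Coprod G (FreeGroup X)),
      BiInvariantDist (Monoid.Coprod G (FreeGroup X)) ∧
      ∀ u v : G ⊕ X,
        dist
          (Sum.elim (fun g => (Monoid.Coprod.inl g : Monoid.Coprod G (FreeGroup X)))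
            (fun x => Monoid.Coprod.inr (FreeGroup.of x)) u)
          (Sum.elim (fun g => (Monoid.Coprod.inl g : Monoid.Coprod G (FreeGroup X)))
            (fun x => Monoid.Coprod.inr (FreeGroup.of x)) v) = d' u v := by
  have hl : ∀ a b c : G, d' (Sum.inl (a * b)) (Sum.inl (a * c)) = d' (Sum.inl b) (Sum.inl c) :=
    fun a b c => by rw [hdG, hdG]; exact (hbi a b c).1
  have hr : ∀ a b c : G, d' (Sum.inl (b * a)) (Sum.inl (c * a)) = d' (Sum.inl b) (Sum.inl c) :=
    fun a b c => by rw [hdG, hdG]; exact (hbi a b c).2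
  obtain ⟨M, h1, h2⟩ := Graev.main_of_LM (Graev.LM_sd hd' hl hr hpos)
  refine ⟨M, h1, ?_⟩
  rintro (a | x) (b | y)
  · exact h2 (.g a) (.g b)
  · exact h2 (.g a) (.p y)
  · exact h2 (.p x) (.g b)
  · exact h2 (.p x) (.p y)
end

section
/- Let K > 0 be rational and let S₀, S₁, S₂ be finite pairwise disjoint sets. Let d₁ be a finitely generated rational metric bounded by K on the free group F(S₀ ∪ S₁) and let d₂ be a finitely generated rational metric bounded by K on the free group F(S₀ ∪ S₂), such that the restrictions of d₁ and d₂ to the common subgroup F(S₀) coincide and the inclusions F(S₀) ↪ F(S₀ ∪ S₁), F(S₀) ↪ F(S₀ ∪ S₂) are isometric with respect to a finitely generated rational metric bounded by K on F(S₀). Then there exists a finitely generated rational metric d₃ bounded by K on the free group F(S₀ ∪ S₁ ∪ S₂) such that the canonical inclusions of F(S₀ ∪ S₁) and of F(S₀ ∪ S₂) into F(S₀ ∪ S₁ ∪ S₂) (sending free generators to free generators) are isometric group monomorphisms with respect to d₁, respectively d₂, and d₃. (Amalgamation property for the class of finitely generated rational K-bounded metrics on finitely generated free groups.) -/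
/-- `d` is a finitely generated metric on the group `G`: it is a bi-invariant metric and
there is a finite symmetric set `A` containing `1` such that `d a b` is the minimum of
`d a₁ b₁ + ⋯ + d aₘ bₘ` over all decompositions `a = a₁⋯aₘ`, `b = b₁⋯bₘ` with all
`aᵢ, bᵢ ∈ A`. -/
def IsFinGenMetric {G : Type*} [Group G] (d : G → G → ℝ) : Prop :=
  IsBiInvMetric d ∧ ∃ A : Finset G, (1 : G) ∈ A ∧ (∀ a ∈ A, a⁻¹ ∈ A) ∧
    ∀ a b : G, IsLeast {s : ℝ | ∃ l : List (G × G), (∀ q ∈ l, q.1 ∈ A ∧ q.2 ∈ A) ∧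
      (l.map Prod.fst).prod = a ∧ (l.map Prod.snd).prod = b ∧
      s = (l.map fun q => d q.1 q.2).sum} (d a b)

/-- The `K`-bounded variant of a finitely generated metric: `d a b` is the minimum of `K` and
of the sums `d a₁ b₁ + ⋯ + d aₘ bₘ` over all decompositions with letters in `A`. -/
def IsFinGenMetricBdd {G : Type*} [Group G] (K : ℝ) (d : G → G → ℝ) : Prop :=
  IsBiInvMetric d ∧ ∃ A : Finset G, (1 : G) ∈ A ∧ (∀ a ∈ A, a⁻¹ ∈ A) ∧
    ∀ a b : G, IsLeast {s : ℝ | ∃ l : List (G × G), (∀ q ∈ l, q.1 ∈ A ∧ q.2 ∈ A) ∧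
      (l.map Prod.fst).prod = a ∧ (l.map Prod.snd).prod = b ∧
      s = min K ((l.map fun q => d q.1 q.2).sum)} (d a b)


namespace Amalg

/-- Weighted reductions of alternating words. -/
inductive Red {G : Type} [Group G] (H0 : Subgroup G) (ℓ : G → ℝ) : List G → ℝ → Prop
  | base (y : G) (r : ℝ) (h : ℓ y ≤ r) : Red H0 ℓ [y] r
  | step (p : List G) (y x a z : G) (s : List G) (r r' : ℝ) (ha : a ∈ H0)
      (h : Red H0 ℓ (p ++ (y * a * z) :: s) r) (hr : r + ℓ (x⁻¹ * a) ≤ r') :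
      Red H0 ℓ (p ++ y :: x :: z :: s) r'

/-- Alternating words. -/
def Alt {G : Type} [Group G] (H : Bool → Subgroup G) : Bool → List G → Prop
  | _, [] => True
  | b, x :: l => x ∈ H b ∧ Alt H (!b) l

/-- Parity shift. -/
def sh {G : Type} : Bool → List G → Bool
  | b, [] => b
  | b, _ :: l => sh (!b) l

/-- The data of compatible norms. -/
structure Nrm {G : Type} [Group G] (H : Bool → Subgroup G) (H0 : Subgroup G) (ℓ : G → ℝ) :
    Prop where
  le : ∀ k, H0 ≤ H k
  one : ℓ 1 = 0
  mul : ∀ k, ∀ x ∈ H k, ∀ y ∈ H k, ℓ (x * y) ≤ ℓ x + ℓ y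
  conj : ∀ k, ∀ x ∈ H k, ∀ y ∈ H k, ℓ (y⁻¹ * x * y) = ℓ x
  inv : ∀ k, ∀ x ∈ H k, ℓ x⁻¹ = ℓ x

section
variable {G : Type} [Group G] {H : Bool → Subgroup G} {H0 : Subgroup G} {ℓ : G → ℝ}

theorem sh_not (b : Bool) (p : List G) : sh (!b) p = !(sh b p) := by
  induction p generalizing b with
  | nil => rfl
  | cons x l ih => simp only [sh, ih]

theorem sh_cons (b : Bool) (x : G) (p : List G) : sh b (x :: p) = !(sh b p) := by
  simp only [sh, sh_not]

theorem sh_append (b : Bool) (p q : List G) : sh b (p ++ q) = sh (sh b p) q := by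
  induction p generalizing b with
  | nil => rfl
  | cons x l ih => simp only [List.cons_append, sh, ih]

theorem alt_append (b : Bool) (p q : List G) :
    Alt H b (p ++ q) ↔ Alt H b p ∧ Alt H (sh b p) q := by
  induction p generalizing b with
  | nil => simp [Alt, sh]
  | cons x l ih => simp only [List.cons_append, sh, ih, Alt, and_assoc]

theorem Red.mono {w : List G} {r r' : ℝ} (h : Red H0 ℓ w r) (hr : r ≤ r') : Red H0 ℓ w r' := by
  cases h with
  | base y _ h => exact .base y r' (h.trans hr)
  | step p y x a z s r0 _ ha h h' => exact .step p y x a z s r0 r' ha h (h'.trans hr)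

theorem cases1 {p s q t : List G} {c u x v : G} (h : q ++ u :: x :: v :: t = p ++ c :: s) :
    (∃ m, q = p ++ c :: m ∧ s = m ++ u :: x :: v :: t) ∨ (q = p ∧ c = u ∧ s = x :: v :: t) ∨
    (p = q ++ [u] ∧ c = x ∧ s = v :: t) ∨ (p = q ++ [u, x] ∧ c = v ∧ s = t) ∨
    (∃ m, p = q ++ u :: x :: v :: m ∧ t = m ++ c :: s) := by
  induction q generalizing p with
  | nil =>
    rcases p with _ | ⟨p1, _ | ⟨p2, _ | ⟨p3, p⟩⟩⟩ <;>
      simp only [List.nil_append, List.cons_append, List.cons.injEq] at h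
    · obtain ⟨rfl, rfl⟩ := h
      exact Or.inr (Or.inl ⟨rfl, rfl, rfl⟩)
    · obtain ⟨rfl, rfl, rfl⟩ := h
      exact Or.inr (Or.inr (Or.inl ⟨rfl, rfl, rfl⟩))
    · obtain ⟨rfl, rfl, rfl, rfl⟩ := h
      exact Or.inr (Or.inr (Or.inr (Or.inl ⟨rfl, rfl, rfl⟩)))
    · obtain ⟨rfl, rfl, rfl, rfl⟩ := h
      exact Or.inr (Or.inr (Or.inr (Or.inr ⟨p, rfl, rfl⟩)))
  | cons q1 q ih =>
    rcases p with _ | ⟨p1, p⟩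
    · simp at h
      left; exact ⟨q, by simp [h.1], h.2.symm⟩
    · simp only [List.cons_append, List.cons.injEq] at h
      obtain ⟨rfl, h⟩ := h
      rcases ih h with ⟨m, rfl, rfl⟩ | ⟨rfl, rfl, rfl⟩ | ⟨rfl, rfl, rfl⟩ | ⟨rfl, rfl, rfl⟩ |
        ⟨m, rfl, rfl⟩
      · exact Or.inl ⟨m, rfl, rfl⟩
      · exact Or.inr (Or.inl ⟨rfl, rfl, rfl⟩)
      · exact Or.inr (Or.inr (Or.inl ⟨rfl, rfl, rfl⟩))
      · exact Or.inr (Or.inr (Or.inr (Or.inl ⟨rfl, rfl, rfl⟩)))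
      · exact Or.inr (Or.inr (Or.inr (Or.inr ⟨m, rfl, rfl⟩)))

theorem cases2 {p s q t : List G} {c d u x v : G}
    (h : q ++ u :: x :: v :: t = p ++ c :: d :: s) :
    (∃ m, q = p ++ c :: d :: m ∧ s = m ++ u :: x :: v :: t) ∨
    (q = p ++ [c] ∧ d = u ∧ s = x :: v :: t) ∨
    (q = p ∧ c = u ∧ d = x ∧ s = v :: t) ∨
    (p = q ++ [u] ∧ c = x ∧ d = v ∧ s = t) ∨ (p = q ++ [u, x] ∧ c = v ∧ t = d :: s) ∨
    (∃ m, p = q ++ u :: x :: v :: m ∧ t = m ++ c :: d :: s) := by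
  rcases cases1 h with ⟨m, h1, h2⟩ | h | h | h | h
  · rcases m with _ | ⟨m1, m⟩
    · simp_all
    · left; exact ⟨m, by simp_all, by simp_all⟩
  all_goals simp_all

theorem cases3 {p s q t : List G} {c d e u x v : G}
    (h : q ++ u :: x :: v :: t = p ++ c :: d :: e :: s) :
    (∃ m, q = p ++ c :: d :: e :: m ∧ s = m ++ u :: x :: v :: t) ∨
    (q = p ++ [c, d] ∧ e = u ∧ s = x :: v :: t) ∨
    (q = p ++ [c] ∧ d = u ∧ e = x ∧ s = v :: t) ∨
    (q = p ∧ c = u ∧ d = x ∧ e = v ∧ s = t) ∨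
    (p = q ++ [u] ∧ c = x ∧ d = v ∧ t = e :: s) ∨ (p = q ++ [u, x] ∧ c = v ∧ t = d :: e :: s) ∨
    (∃ m, p = q ++ u :: x :: v :: m ∧ t = m ++ c :: d :: e :: s) := by
  rcases cases2 h with ⟨m, h1, h2⟩ | h | h | h | h | h
  · rcases m with _ | ⟨m1, m⟩
    · simp_all
    · left; exact ⟨m, by simp_all, by simp_all⟩
  all_goals simp_all

theorem alt_mid {b : Bool} {p s : List G} {y : G} : Alt H b (p ++ y :: s) ↔
    Alt H b p ∧ y ∈ H (sh b p) ∧ Alt H (!(sh b p)) s := by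
  rw [alt_append]; rfl

theorem alt_step (N : Nrm H H0 ℓ) {b : Bool} {p s : List G} {y x a z : G} (ha : a ∈ H0)
    (h : Alt H b (p ++ y :: x :: z :: s)) : Alt H b (p ++ (y * a * z) :: s) := by
  simp only [alt_mid, Alt, Bool.not_not] at h ⊢
  exact ⟨h.1, mul_mem (mul_mem h.2.1 (N.le _ ha)) h.2.2.2.1, h.2.2.2.2⟩

/-- perturbing a letter -/
theorem red_perturb (N : Nrm H H0 ℓ) {w : List G} {r : ℝ} (h : Red H0 ℓ w r) :
    ∀ (b : Bool) (p s : List G) (y y' : G), w = p ++ y' :: s → Alt H b w → y ∈ H (sh b p) →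
      Red H0 ℓ (p ++ y :: s) (r + ℓ (y'⁻¹ * y)) := by
  induction h with
  | base u r h =>
    intro b p s y y' hw ha hy
    rcases p with _ | ⟨p1, p⟩
    · simp at hw
      obtain ⟨rfl, rfl⟩ := hw
      refine .base _ _ ?_
      have := N.mul b u ha.1 (u⁻¹ * y) (mul_mem (inv_mem ha.1) hy)
      rw [mul_inv_cancel_left] at this
      linarith
    · simp at hw
  | step q u x a v t r r' ha0 h hr ih =>
    intro b p s y y' hw ha hy
    have ha' := alt_step N ha0 ha
    rcases cases1 hw with ⟨m, rfl, rfl⟩ | ⟨rfl, rfl, rfl⟩ | ⟨rfl, rfl, rfl⟩ | ⟨rfl, rfl, rfl⟩ |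
      ⟨m, rfl, rfl⟩
    · have := ih b p (m ++ (u * a * v) :: t) y y' (by simp) ha' hy
      have h2 := Red.step (ℓ := ℓ) (p ++ y :: m) u x a v t _ (r' + ℓ (y'⁻¹ * y)) ha0
        (by simpa using this) (by linarith)
      simpa using h2
    · simp only [alt_mid, Alt, Bool.not_not] at ha
      have hav := mul_mem (N.le _ ha0) ha.2.2.2.1
      have := ih b q t (y * a * v) (y' * a * v) rfl ha'
        (mul_mem (mul_mem hy (N.le _ ha0)) ha.2.2.2.1)
      have e : ℓ ((y' * a * v)⁻¹ * (y * a * v)) = ℓ (y'⁻¹ * y) := by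
        rw [← N.conj _ (y'⁻¹ * y) (mul_mem (inv_mem ha.2.1) hy) _ hav]; congr 1; group
      rw [e] at this
      exact .step q y x a v t _ _ ha0 this (by linarith)
    · simp only [alt_mid, Alt, Bool.not_not] at ha
      simp only [sh_append, sh] at hy
      have e := N.mul _ (y⁻¹ * y') (mul_mem (inv_mem hy) ha.2.2.1) (y'⁻¹ * a)
        (mul_mem (inv_mem ha.2.2.1) (N.le _ ha0))
      have e2 := N.inv _ (y⁻¹ * y') (mul_mem (inv_mem hy) ha.2.2.1)
      have e3 : y⁻¹ * y' * (y'⁻¹ * a) = y⁻¹ * a := by group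
      rw [e3] at e
      simp only [mul_inv_rev, inv_inv] at e2
      have := Red.step (ℓ := ℓ) q u y a v t r (r' + ℓ (y'⁻¹ * y)) ha0 h (by linarith)
      simpa using this
    · simp only [alt_mid, Alt, Bool.not_not] at ha
      simp only [sh_append, sh, Bool.not_not] at hy
      have := ih b q s (u * a * y) (u * a * y') rfl ha'
        (mul_mem (mul_mem ha.2.1 (N.le _ ha0)) hy)
      have e : (u * a * y')⁻¹ * (u * a * y) = y'⁻¹ * y := by group
      rw [e] at this
      have := Red.step (ℓ := ℓ) q u x a y s _ (r' + ℓ (y'⁻¹ * y)) ha0 this (by linarith)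
      simpa using this
    · have hs : sh b (q ++ u :: x :: v :: m) = sh b (q ++ (u * a * v) :: m) := by
        simp [sh_append, sh]
      have := ih b (q ++ (u * a * v) :: m) s y y' (by simp) ha' (by rw [← hs]; exact hy)
      have := Red.step (ℓ := ℓ) q u x a v (m ++ y :: s) _ (r' + ℓ (y'⁻¹ * y)) ha0
        (by simpa using this) (by linarith)
      simpa using this

/-- transfer of an element of `H0` between neighbours -/
theorem red_transfer (N : Nrm H H0 ℓ) {w : List G} {r : ℝ} (h : Red H0 ℓ w r) :
    ∀ (b : Bool) (p s : List G) (y z c : G), w = p ++ y :: z :: s → Alt H b w → c ∈ H0 →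
      Red H0 ℓ (p ++ (y * c⁻¹) :: (c * z) :: s) r := by
  induction h with
  | base u r h =>
    intro b p s y z c hw
    rcases p with _ | ⟨p1, p⟩ <;> simp at hw
  | step q u x a v t r r' ha0 h hr ih =>
    intro b p s y z c hw ha hc
    have ha' := alt_step N ha0 ha
    rcases cases2 hw with ⟨m, rfl, rfl⟩ | ⟨rfl, rfl, rfl⟩ | ⟨rfl, rfl, rfl, rfl⟩ |
      ⟨rfl, rfl, rfl, rfl⟩ | ⟨rfl, rfl, rfl⟩ | ⟨m, rfl, rfl⟩
    · have := ih b p (m ++ (u * a * v) :: t) y z c (by simp) ha' hc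
      have h2 := Red.step (ℓ := ℓ) (p ++ (y * c⁻¹) :: (c * z) :: m) u x a v t _ r' ha0
        (by simpa using this) (by linarith)
      simpa using h2
    · have := ih b p t y (z * a * v) c (by simp) ha' hc
      have h2 := Red.step (ℓ := ℓ) (p ++ [y * c⁻¹]) (c * z) x a v t r r' ha0
        (by simpa [mul_assoc] using this) (by linarith)
      simpa using h2
    · simp only [alt_mid, Alt, Bool.not_not] at ha
      have e : (c * z)⁻¹ * (c * a) = z⁻¹ * a := by group
      exact Red.step (ℓ := ℓ) q (y * c⁻¹) (c * z) (c * a) v t r r' (mul_mem hc ha0)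
        (by simpa [mul_assoc] using h) (by rw [e]; linarith)
    · simp only [alt_mid, Alt, Bool.not_not] at ha
      have e : ℓ ((y * c⁻¹)⁻¹ * (a * c⁻¹)) = ℓ (y⁻¹ * a) := by
        rw [← N.conj _ (y⁻¹ * a) (mul_mem (inv_mem ha.2.2.1) (N.le _ ha0)) c⁻¹
          (inv_mem (N.le _ hc))]
        congr 1; group
      have := Red.step (ℓ := ℓ) q u (y * c⁻¹) (a * c⁻¹) (c * z) s r r'
        (mul_mem ha0 (inv_mem hc))
        (by simpa [mul_assoc] using h) (by rw [e]; linarith)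
      simpa using this
    · have := ih b q s (u * a * y) z c (by simp) ha' hc
      have h2 := Red.step (ℓ := ℓ) q u x a (y * c⁻¹) ((c * z) :: s) r r' ha0
        (by simpa [mul_assoc] using this) (by linarith)
      simpa using h2
    · have := ih b (q ++ (u * a * v) :: m) s y z c (by simp) ha' hc
      have := Red.step (ℓ := ℓ) q u x a v (m ++ (y * c⁻¹) :: (c * z) :: s) _ r' ha0
        (by simpa using this) (by linarith)
      simpa using this

/-- the collapse lower bound -/
theorem red_collapse (N : Nrm H H0 ℓ) {w : List G} {r : ℝ} (h : Red H0 ℓ w r) :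
    ∀ (b : Bool) (p s : List G) (y x z a : G), w = p ++ y :: x :: z :: s → Alt H b w → a ∈ H0 →
      Red H0 ℓ (p ++ (y * a * z) :: s) (r + ℓ (x⁻¹ * a)) := by
  induction h with
  | base u r h =>
    intro b p s y x z a hw
    rcases p with _ | ⟨p1, p⟩ <;> simp at hw
  | step q u x' c v t r r' hc0 h hr ih =>
    intro b p s y x z a hw ha ha0
    have ha' := alt_step N hc0 ha
    rcases cases3 hw with ⟨m, rfl, rfl⟩ | ⟨rfl, rfl, rfl⟩ | ⟨rfl, rfl, rfl, rfl⟩ |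
      ⟨rfl, rfl, rfl, rfl, rfl⟩ |
      ⟨rfl, rfl, rfl, rfl⟩ | ⟨rfl, rfl, rfl⟩ | ⟨m, rfl, rfl⟩
    · have := ih b p (m ++ (u * c * v) :: t) y x z a (by simp) ha' ha0
      have h2 := Red.step (ℓ := ℓ) (p ++ (y * a * z) :: m) u x' c v t _ (r' + ℓ (x⁻¹ * a)) hc0
        (by simpa using this) (by linarith)
      simpa using h2
    · have := ih b p t y x (z * c * v) a (by simp) ha' ha0
      exact Red.step (ℓ := ℓ) p (y * a * z) x' c v t _ (r' + ℓ (x⁻¹ * a)) hc0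
        (by simpa [mul_assoc] using this) (by linarith)
    · -- word p, y, x, z, v, t ; have p, y, x c v, t
      simp only [alt_mid, sh_append, sh, List.append_assoc, List.cons_append, List.nil_append,
        Alt, Bool.not_not] at ha
      obtain ⟨hp, hy, hx, hz, hv, ht⟩ := ha
      have hA : ∀ k, a ∈ H k := fun k => N.le k ha0
      have hC : ∀ k, c ∈ H k := fun k => N.le k hc0
      have h1 := red_perturb N h b (p ++ [y]) t (a * c * v) (x * c * v) rfl ha'
        (by simp only [sh_append, sh]; exact mul_mem (mul_mem (hA _) (hC _)) hv)
      have e1 : ℓ ((x * c * v)⁻¹ * (a * c * v)) = ℓ (x⁻¹ * a) := by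
        rw [← N.conj _ (x⁻¹ * a) (mul_mem (inv_mem hx) (hA _)) (c * v) (mul_mem (hC _) hv)]
        congr 1; group
      rw [e1] at h1
      have h2 := red_transfer N h1 b p t y (a * c * v) (a * c)⁻¹ (by simp)
        (by simp only [alt_mid, sh_append, sh, List.append_assoc, List.cons_append,
              List.nil_append, Alt, Bool.not_not]
            exact ⟨hp, hy, mul_mem (mul_mem (hA _) (hC _)) hv, ht⟩)
        (inv_mem (mul_mem ha0 hc0))
      have h3 := red_perturb N h2 b p _ (y * a * z) _ rfl
        (by simp only [alt_mid, sh_append, sh, List.append_assoc, List.cons_append,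
              List.nil_append, Alt, Bool.not_not]
            refine ⟨hp, mul_mem hy (inv_mem (inv_mem (mul_mem (hA _) (hC _)))), ?_, ht⟩
            rwa [inv_mul_cancel_left]) (mul_mem (mul_mem hy (hA _)) hz)
      have e2 : (y * (a * c)⁻¹⁻¹)⁻¹ * (y * a * z) = (z⁻¹ * c)⁻¹ := by group
      rw [e2, N.inv _ _ (mul_mem (inv_mem hz) (hC _))] at h3
      have h4 := h3.mono (show _ ≤ r' + ℓ (x⁻¹ * a) by linarith)
      simpa [mul_assoc] using h4
    · simp only [alt_mid, Alt, Bool.not_not] at ha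
      obtain ⟨hp, hy, hx, hz, ht⟩ := ha
      have hA : ∀ k, a ∈ H k := fun k => N.le k ha0
      have hC : ∀ k, c ∈ H k := fun k => N.le k hc0
      have h1 := red_perturb N h b q s (y * a * z) _ rfl ha' (mul_mem (mul_mem hy (hA _)) hz)
      have e1 : ℓ ((y * c * z)⁻¹ * (y * a * z)) = ℓ (c⁻¹ * a) := by
        rw [← N.conj _ (c⁻¹ * a) (mul_mem (inv_mem (hC _)) (hA _)) z hz]
        congr 1; group
      have e2 := N.mul _ (c⁻¹ * x) (mul_mem (inv_mem (hC _)) hx) (x⁻¹ * a)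
        (mul_mem (inv_mem hx) (hA _))
      have e3 := N.inv _ (x⁻¹ * c) (mul_mem (inv_mem hx) (hC _))
      have e4 : (c⁻¹ * x) * (x⁻¹ * a) = c⁻¹ * a := by group
      rw [e4] at e2
      simp only [mul_inv_rev, inv_inv] at e3
      rw [e1] at h1
      exact h1.mono (by linarith)
    · -- word q, u, y, x, z, s ; have q, u c x, z, s ; want q, u, y a z, s
      simp only [alt_mid, sh_append, sh, List.append_assoc, List.cons_append, List.nil_append,
        Alt, Bool.not_not] at ha
      obtain ⟨hp, hu, hy, hx, hz, ht⟩ := ha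
      have hA : ∀ k, a ∈ H k := fun k => N.le k ha0
      have hC : ∀ k, c ∈ H k := fun k => N.le k hc0
      have h1 := red_perturb N h b q (z :: s) (u * c * a) (u * c * x) rfl ha'
        (mul_mem (mul_mem hu (hC _)) (hA _))
      have e1 : (u * c * x)⁻¹ * (u * c * a) = x⁻¹ * a := by group
      rw [e1] at h1
      have h2 := red_transfer N h1 b q s (u * c * a) z (c * a) (by simp)
        (by simp only [alt_mid, Alt, Bool.not_not]
            exact ⟨hp, mul_mem (mul_mem hu (hC _)) (hA _), hz, ht⟩)
        (mul_mem hc0 ha0)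
      have e0 : u * c * a * (c * a)⁻¹ = u := by group
      rw [e0] at h2
      have h3 := red_perturb N h2 b (q ++ [u]) s (y * a * z) (c * a * z) (by simp)
        (by simp only [alt_mid, Alt, Bool.not_not]
            exact ⟨hp, hu, mul_mem (mul_mem (hC _) (hA _)) hz, ht⟩)
        (by simp only [sh_append, sh]; exact mul_mem (mul_mem hy (hA _)) hz)
      have e2 : ℓ ((c * a * z)⁻¹ * (y * a * z)) = ℓ (c⁻¹ * y) := by
        rw [← N.conj _ (c⁻¹ * y) (mul_mem (inv_mem (hC _)) hy) (a * z) (mul_mem (hA _) hz)]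
        congr 1; group
      have e3 := N.inv _ (y⁻¹ * c) (mul_mem (inv_mem hy) (hC _))
      simp only [mul_inv_rev, inv_inv] at e3
      rw [e2, e3] at h3
      exact h3.mono (show _ ≤ r' + ℓ (x⁻¹ * a) by linarith)
    · have := ih b q s (u * c * y) x z a (by simp) ha' ha0
      have := Red.step (ℓ := ℓ) q u x' c (y * a * z) s _ (r' + ℓ (x⁻¹ * a)) hc0
        (by simpa [mul_assoc] using this) (by linarith)
      simpa using this
    · have := ih b (q ++ (u * c * v) :: m) s y x z a (by simp) ha' ha0
      have := Red.step (ℓ := ℓ) q u x' c v (m ++ (y * a * z) :: s) _ (r' + ℓ (x⁻¹ * a)) hc0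
        (by simpa using this) (by linarith)
      simpa using this

theorem red_iff (N : Nrm H H0 ℓ) (b : Bool) (p s : List G) (y a z : G) (r : ℝ)
    (h : Alt H b (p ++ y :: a :: z :: s)) (ha : a ∈ H0) :
    Red H0 ℓ (p ++ y :: a :: z :: s) r ↔ Red H0 ℓ (p ++ (y * a * z) :: s) r := by
  constructor
  · intro hr
    have := red_collapse N hr b p s y a z a rfl h ha
    rwa [inv_mul_cancel, N.one, add_zero] at this
  · intro hr
    exact .step p y a a z s r r ha hr (by rw [inv_mul_cancel, N.one, add_zero])

/-- flattening a word of pairs -/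
def fl (H : Bool → Subgroup G) : List (H true × H false) → List G
  | [] => []
  | q :: l => (q.1 : G) :: (q.2 : G) :: fl H l

theorem fl_append (l l' : List (H true × H false)) : fl H (l ++ l') = fl H l ++ fl H l' := by
  induction l with
  | nil => rfl
  | cons q l ih => simp [fl, ih]

theorem alt_fl (l : List (H true × H false)) (s : List G) (hs : Alt H true s) :
    Alt H true (fl H l ++ s) := by
  induction l with
  | nil => simpa [fl] using hs
  | cons q l ih => simpa [fl, Alt] using ih

theorem sh_fl (l : List (H true × H false)) : sh true (fl H l) = true := by
  induction l with
  | nil => rfl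
  | cons q l ih => simpa [fl, sh] using ih

/-- the syntactic congruence -/
def synCon (H : Bool → Subgroup G) (H0 : Subgroup G) (ℓ : G → ℝ) :
    Con (FreeMonoid (H true × H false)) where
  r w w' := ∀ (p : List (H true × H false)) (y : G) (s : List G), Alt H true (y :: s) →
    ∀ r, Red H0 ℓ (fl H p ++ (fl H w.toList ++ y :: s)) r ↔
      Red H0 ℓ (fl H p ++ (fl H w'.toList ++ y :: s)) r
  iseqv := ⟨fun _ _ _ _ _ _ => Iff.rfl, fun h p y s hs r => (h p y s hs r).symm,
    fun h h' p y s hs r => (h p y s hs r).trans (h' p y s hs r)⟩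
  mul' := by
    intro w x y z h1 h2 p t s hs r
    have e2 := h2 (p ++ w.toList) t s hs r
    simp only [FreeMonoid.toList_mul, fl_append, List.append_assoc] at e2 ⊢
    rw [e2]
    obtain ⟨t', s', hts⟩ : ∃ t' s', fl H z.toList ++ t :: s = t' :: s' := by
      cases hz : fl H z.toList ++ t :: s with
      | nil => simp at hz
      | cons a b => exact ⟨a, b, rfl⟩
    have := alt_fl z.toList (t :: s) hs
    rw [hts] at this ⊢
    exact h1 p t' s' this r

theorem core (N : Nrm H H0 ℓ)
    (univ : ∀ (Q : Type) [Monoid Q] (j1 : H true →* Q) (j2 : H false →* Q),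
      (∀ a (ha : a ∈ H0), j1 ⟨a, N.le _ ha⟩ = j2 ⟨a, N.le _ ha⟩) →
      ∃ J : G →* Q, (∀ x : H true, J x = j1 x) ∧ ∀ x : H false, J x = j2 x)
    (l : List (G × G)) (hl : ∀ q ∈ l, ∃ k, q.1 ∈ H k ∧ q.2 ∈ H k) (u : G) (hu : u ∈ H true)
    (h1 : (l.map Prod.fst).prod = 1) (h2 : (l.map Prod.snd).prod = u) :
    ℓ u ≤ (l.map fun q => ℓ (q.1⁻¹ * q.2)).sum := by
  let c := synCon H H0 ℓ
  let m : H true × H false → c.Quotient := fun q => (FreeMonoid.of q : FreeMonoid _)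
  have key : ∀ w w' : FreeMonoid (H true × H false),
      (∀ (p : List (H true × H false)) (y : G) (s : List G), Alt H true (y :: s) →
        ∀ r, Red H0 ℓ (fl H p ++ (fl H w.toList ++ y :: s)) r ↔
        Red H0 ℓ (fl H p ++ (fl H w'.toList ++ y :: s)) r) → (w : c.Quotient) = w' :=
    fun w w' h => c.eq.2 h
  have one0 : (1 : G) ∈ H0 := one_mem _
  have halt : ∀ (p : List (H true × H false)) (s : List G), Alt H true s →
      Alt H true (fl H p ++ s) := fun p s hs => alt_fl p s hs
  have hone : m (1, 1) = 1 := by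
    refine key (FreeMonoid.of (1, 1)) 1 ?_
    intro p y s hs r
    have := red_iff N true (fl H p) s 1 1 y r (halt _ _ (by simpa [Alt] using hs)) one0
    simpa [fl] using this
  have hm1 : ∀ y y' : H true, m (y * y', 1) = m (y, 1) * m (y', 1) := by
    intro y y'
    refine (key (FreeMonoid.of (y, 1) * FreeMonoid.of (y', 1)) (FreeMonoid.of (y * y', 1)) ?_).symm
    intro p z s hs r
    have := red_iff N true (fl H p) (1 :: z :: s) y 1 y' r
      (halt _ _ (by simpa [Alt] using hs)) one0
    simpa [fl] using this
  have hm2 : ∀ x x' : H false, m (1, x * x') = m (1, x) * m (1, x') := by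
    intro x x'
    refine (key (FreeMonoid.of (1, x) * FreeMonoid.of (1, x')) (FreeMonoid.of (1, x * x')) ?_).symm
    intro p z s hs r
    have := red_iff N true (fl H p ++ [1]) (z :: s) x 1 x' r
      (by simpa using halt p (1 :: x :: 1 :: x' :: z :: s) (by simpa [Alt] using hs)) one0
    simpa [fl] using this
  have hm3 : ∀ (y : H true) (x : H false), m (y, x) = m (y, 1) * m (1, x) := by
    intro y x
    refine (key (FreeMonoid.of (y, 1) * FreeMonoid.of (1, x)) (FreeMonoid.of (y, x)) ?_).symm
    intro p z s hs r
    have := red_iff N true (fl H p) (x :: z :: s) y 1 1 r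
      (halt _ _ (by simpa [Alt] using hs)) one0
    simpa [fl] using this
  have hm0 : ∀ a (ha : a ∈ H0), m (⟨a, N.le _ ha⟩, 1) = m (1, ⟨a, N.le _ ha⟩) := by
    intro a ha
    refine key (FreeMonoid.of (⟨a, N.le _ ha⟩, 1)) (FreeMonoid.of (1, ⟨a, N.le _ ha⟩)) ?_
    intro p z s hs r
    have haa : ∀ k, a ∈ H k := fun k => N.le k ha
    constructor
    · intro h
      have := red_transfer N h true (fl H p) (z :: s) a 1 a (by simp [fl])
        (halt _ _ (by simpa [Alt, fl, haa] using hs)) ha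
      simpa [fl] using this
    · intro h
      have := red_transfer N h true (fl H p) (z :: s) 1 a a⁻¹ (by simp [fl])
        (halt _ _ (by simpa [Alt, fl, haa] using hs)) (inv_mem ha)
      simpa [fl] using this
  let j1 : H true →* c.Quotient := ⟨⟨fun y => m (y, 1), hone⟩, hm1⟩
  let j2 : H false →* c.Quotient := ⟨⟨fun x => m (1, x), hone⟩, hm2⟩
  obtain ⟨J, hJ1, hJ2⟩ := univ c.Quotient j1 j2 hm0
  have hJ : ∀ w : List (H true × H false),
      ((FreeMonoid.ofList w : FreeMonoid _) : c.Quotient) = J (fl H w).prod := by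
    intro w
    induction w with
    | nil => simp [fl]
    | cons q w ih =>
      rw [FreeMonoid.ofList_cons, Con.coe_mul, ih]
      simp only [fl, List.prod_cons, map_mul, hJ1, hJ2]
      rw [← mul_assoc]
      congr 1
      exact hm3 q.1 q.2
  -- words from the pairs
  have words : ∀ l : List (G × G), (∀ q ∈ l, ∃ k, q.1 ∈ H k ∧ q.2 ∈ H k) →
      ∃ A B : List (H true × H false), (fl H A).prod = (l.map Prod.fst).prod ∧
        (fl H B).prod = (l.map Prod.snd).prod ∧
        ∀ (p : List (H true × H false)) (r : ℝ), Red H0 ℓ (fl H p ++ (fl H A ++ [1])) r →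
          Red H0 ℓ (fl H p ++ (fl H B ++ [1])) (r + (l.map fun q => ℓ (q.1⁻¹ * q.2)).sum) := by
    intro l
    induction l with
    | nil =>
      intro _
      exact ⟨[], [], by simp [fl], by simp [fl], by simp⟩
    | cons q l ih =>
      intro hl
      obtain ⟨A, B, hA, hB, hAB⟩ := ih fun q hq => hl q (List.mem_cons_of_mem _ hq)
      obtain ⟨k, hq1, hq2⟩ := hl q List.mem_cons_self
      have aA : ∀ p : List (H true × H false), Alt H true (fl H p ++ (fl H A ++ [1])) :=
        fun p => halt _ _ (halt _ _ (by simp [Alt]))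
      cases k with
      | true =>
        refine ⟨(⟨q.1, hq1⟩, 1) :: A, (⟨q.2, hq2⟩, 1) :: B, by simp [fl, hA], by simp [fl, hB], ?_⟩
        intro p r h
        have h1 := red_perturb N h true (fl H p) (1 :: (fl H A ++ [1])) q.2 q.1 (by simp [fl])
          (halt _ _ (halt _ _ (by simp [Alt]))) (by rw [sh_fl]; exact hq2)
        have h2 := hAB (p ++ [(⟨q.2, hq2⟩, 1)]) _ (by simpa [fl, fl_append] using h1)
        simpa [fl, fl_append, add_assoc] using h2
      | false =>
        refine ⟨(1, ⟨q.1, hq1⟩) :: A, (1, ⟨q.2, hq2⟩) :: B, by simp [fl, hA], by simp [fl, hB], ?_⟩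
        intro p r h
        have h1 := red_perturb N h true (fl H p ++ [1]) (fl H A ++ [1]) q.2 q.1 (by simp [fl])
          (halt _ _ (halt _ _ (by simp [Alt]))) (by rw [sh_append, sh_fl]; exact hq2)
        have h2 := hAB (p ++ [(1, ⟨q.2, hq2⟩)]) _ (by simpa [fl, fl_append] using h1)
        simpa [fl, fl_append, add_assoc] using h2
  obtain ⟨A, B, hA, hB, hAB⟩ := words l hl
  have eA : ((FreeMonoid.ofList A : FreeMonoid _) : c.Quotient) =
      ((1 : FreeMonoid (H true × H false)) : c.Quotient) := by
    rw [hJ, hA, h1, map_one]; rfl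
  have eB : ((FreeMonoid.ofList B : FreeMonoid _) : c.Quotient) =
      ((FreeMonoid.of (⟨u, hu⟩, 1) : FreeMonoid (H true × H false)) : c.Quotient) := by
    rw [hJ, hB, h2]; exact hJ1 ⟨u, hu⟩
  have rA := (c.eq.1 eA) [] 1 [] (by simp [Alt]) 0
  have rB := (c.eq.1 eB) [] 1 [] (by simp [Alt]) (0 + (l.map fun q => ℓ (q.1⁻¹ * q.2)).sum)
  have r1 : Red H0 ℓ [1] 0 := .base 1 0 (by rw [N.one])
  have r2 := hAB [] 0 (rA.2 (by simpa [fl] using r1))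
  have r3 := rB.1 r2
  have r4 := red_iff N true [] [] u 1 1 (0 + (l.map fun q => ℓ (q.1⁻¹ * q.2)).sum)
    (by simp [Alt, hu]) one0
  have r5 : Red H0 ℓ [u] (0 + (l.map fun q => ℓ (q.1⁻¹ * q.2)).sum) := by
    have := r4.1 (by simpa [fl] using r3)
    simpa using this
  generalize hR : (0 + (l.map fun q => ℓ (q.1⁻¹ * q.2)).sum) = R at r5
  rw [zero_add] at hR
  rw [hR]
  generalize hw : [u] = w at r5
  cases r5 with
  | base y _ h => simp at hw; rw [hw]; exact h
  | step p y x a z s r _ ha h hr =>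
    have := congrArg List.length hw
    simp only [List.length_append, List.length_cons, List.length_nil] at this
    omega

end
end Amalg

namespace Amalg

theorem exists_denom {ι : Type} (S : Finset ι) (f : ι → ℝ)
    (hf : ∀ i ∈ S, ∃ q : ℚ, f i = q) (h0 : ∀ i ∈ S, 0 ≤ f i) :
    ∃ M : ℕ, 0 < M ∧ ∀ i ∈ S, ∃ n : ℕ, f i * M = n := by
  classical
  induction S using Finset.induction_on with
  | empty => exact ⟨1, one_pos, by simp⟩
  | insert i S hi ih =>
    obtain ⟨M, hM, h⟩ := ih (fun i hi => hf i (Finset.mem_insert_of_mem hi))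
      (fun i hi => h0 i (Finset.mem_insert_of_mem hi))
    obtain ⟨q, hq⟩ := hf i (Finset.mem_insert_self _ _)
    have hq0 : 0 ≤ q := by
      have := h0 i (Finset.mem_insert_self _ _)
      rw [hq] at this
      exact_mod_cast this
    refine ⟨M * q.den, Nat.mul_pos hM q.pos, ?_⟩
    intro j hj
    rcases Finset.mem_insert.1 hj with rfl | hj
    · refine ⟨q.num.toNat * M, ?_⟩
      have h1 : (q : ℝ) * (q.den : ℝ) = (q.num : ℝ) := by exact_mod_cast Rat.mul_den_eq_num q
      have h2 : ((q.num.toNat : ℕ) : ℝ) = (q.num : ℝ) := by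
        exact_mod_cast congrArg (Int.cast (R := ℝ)) (Int.toNat_of_nonneg (Rat.num_nonneg.2 hq0))
      push_cast
      rw [hq, h2, ← h1]; ring
    · obtain ⟨n, hn⟩ := h j hj
      refine ⟨n * q.den, ?_⟩
      push_cast
      rw [← hn]; ring

section
variable {G : Type} [Group G] {H : Bool → Subgroup G} {H0 : Subgroup G} {ℓ : G → ℝ}

/-- cost of a list of pairs -/
def cost (ℓ : G → ℝ) (l : List (G × G)) : ℝ := (l.map fun q => ℓ (q.1⁻¹ * q.2)).sum

/-- lists of pairs with letters in the same generating set, with given products -/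
def Good (A : Bool → Finset G) (l : List (G × G)) (a b : G) : Prop :=
  (∀ q ∈ l, ∃ k, q.1 ∈ A k ∧ q.2 ∈ A k) ∧ (l.map Prod.fst).prod = a ∧ (l.map Prod.snd).prod = b

theorem Good.append {A : Bool → Finset G} {l l' : List (G × G)} {a b a' b' : G}
    (h : Good A l a b) (h' : Good A l' a' b') : Good A (l ++ l') (a * a') (b * b') := by
  obtain ⟨h1, h2, h3⟩ := h
  obtain ⟨h1', h2', h3'⟩ := h'
  refine ⟨?_, by simp [h2, h2'], by simp [h3, h3']⟩
  intro q hq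
  rcases List.mem_append.1 hq with hq | hq
  · exact h1 q hq
  · exact h1' q hq

theorem cost_append (l l' : List (G × G)) : cost ℓ (l ++ l') = cost ℓ l + cost ℓ l' := by
  simp [cost]

theorem cost_nonneg {A : Bool → Finset G} {l : List (G × G)} {a b : G} (h : Good A l a b)
    (nn : ∀ k, ∀ x ∈ A k, ∀ y ∈ A k, 0 ≤ ℓ (x⁻¹ * y)) : 0 ≤ cost ℓ l := by
  apply List.sum_nonneg
  intro x hx
  obtain ⟨q, hq, rfl⟩ := List.mem_map.1 hx
  obtain ⟨k, h1, h2⟩ := h.1 q hq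
  exact nn k _ h1 _ h2

theorem min_triangle (K x y : ℝ) (hK : 0 < K) (hx : 0 ≤ x) (hy : 0 ≤ y) :
    min K (x + y) ≤ min K x + min K y := by
  rcases le_total K x with h | h <;> rcases le_total K y with h' | h' <;>
    simp [h, h'] <;> (try left; linarith)

theorem amalg_metric (K : ℚ) (hK : 0 < K) (N : Nrm H H0 ℓ)
    (nn : ∀ k, ∀ x ∈ H k, 0 ≤ ℓ x) (pos : ∀ k, ∀ x ∈ H k, ℓ x = 0 → x = 1)
    (bd : ∀ k, ∀ x ∈ H k, ℓ x ≤ (K : ℝ)) (rat : ∀ k, ∀ x ∈ H k, ∃ q : ℚ, ℓ x = q)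
    (A : Bool → Finset G) (hA : ∀ k, ∀ x ∈ A k, x ∈ H k) (hA1 : (1 : G) ∈ A true)
    (hAi : ∀ k, ∀ x ∈ A k, x⁻¹ ∈ A k)
    (gen : ∀ k, ∀ a ∈ H k, ∀ b ∈ H k, ∃ l : List (G × G), (∀ q ∈ l, q.1 ∈ A k ∧ q.2 ∈ A k) ∧
      (l.map Prod.fst).prod = a ∧ (l.map Prod.snd).prod = b ∧
      min (K : ℝ) (cost ℓ l) = ℓ (a⁻¹ * b))
    (top : ∀ g : G, ∃ l : List G, (∀ x ∈ l, ∃ k, x ∈ A k) ∧ l.prod = g)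
    (cor : ∀ k, ∀ a ∈ H k, ∀ b ∈ H k, ∀ l : List (G × G), Good A l a b →
      ℓ (a⁻¹ * b) ≤ cost ℓ l) :
    ∃ d : G → G → ℝ, IsFinGenMetricBdd (K : ℝ) d ∧ (∀ a b, ∃ q : ℚ, d a b = (q : ℝ)) ∧
      ∀ k, ∀ a ∈ H k, ∀ b ∈ H k, d a b = ℓ (a⁻¹ * b) := by
  classical
  have hKr : (0 : ℝ) < K := by exact_mod_cast hK
  have hHm : ∀ k, ∀ x ∈ A k, ∀ y ∈ A k, x⁻¹ * y ∈ H k := fun k x hx y hy =>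
    mul_mem (inv_mem (hA k x hx)) (hA k y hy)
  have nnA : ∀ k, ∀ x ∈ A k, ∀ y ∈ A k, 0 ≤ ℓ (x⁻¹ * y) := fun k x hx y hy =>
    nn k _ (hHm k x hx y hy)
  obtain ⟨M, hM, hMn⟩ := exists_denom
    (A true ×ˢ A true ∪ A false ×ˢ A false) (fun q : G × G => ℓ (q.1⁻¹ * q.2))
    (by
      intro q hq
      rcases Finset.mem_union.1 hq with hq | hq
      · exact rat true _ (hHm _ _ (Finset.mem_product.1 hq).1 _ (Finset.mem_product.1 hq).2)
      · exact rat false _ (hHm _ _ (Finset.mem_product.1 hq).1 _ (Finset.mem_product.1 hq).2))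
    (by
      intro q hq
      rcases Finset.mem_union.1 hq with hq | hq
      · exact nn true _ (hHm _ _ (Finset.mem_product.1 hq).1 _ (Finset.mem_product.1 hq).2)
      · exact nn false _ (hHm _ _ (Finset.mem_product.1 hq).1 _ (Finset.mem_product.1 hq).2))
  have hMr : (0 : ℝ) < M := by exact_mod_cast hM
  have hcost : ∀ l : List (G × G), (∀ q ∈ l, ∃ k, q.1 ∈ A k ∧ q.2 ∈ A k) →
      ∃ n : ℕ, cost ℓ l * M = n := by
    intro l
    induction l with
    | nil => intro _; exact ⟨0, by simp [cost]⟩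
    | cons q l ih =>
      intro h
      obtain ⟨n, hn⟩ := ih fun q hq => h q (List.mem_cons_of_mem _ hq)
      obtain ⟨k, hk⟩ := h q List.mem_cons_self
      obtain ⟨n', hn'⟩ := hMn q (by cases k <;> simp [hk])
      refine ⟨n' + n, ?_⟩
      push_cast
      rw [← hn, ← hn']
      simp [cost]; ring
  have diag : ∀ g : G, ∃ l, Good A l g g ∧ cost ℓ l = 0 := by
    intro g
    obtain ⟨l, hl, rfl⟩ := top g
    refine ⟨l.map fun x => (x, x), ⟨?_, ?_, ?_⟩, ?_⟩
    · intro q hq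
      obtain ⟨x, hx, rfl⟩ := List.mem_map.1 hq
      obtain ⟨k, hk⟩ := hl x hx
      exact ⟨k, hk, hk⟩
    · simp [Function.comp_def]
    · simp [Function.comp_def]
    · simp [cost, Function.comp_def, N.one]
  have ex : ∀ a b : G, ∃ l, Good A l a b := by
    intro a b
    -- pair everything with `1`
    have aux : ∀ l : List G, (∀ x ∈ l, ∃ k, x ∈ A k) → ∃ l', Good A l' l.prod 1 := by
      intro l
      induction l with
      | nil => intro _; exact ⟨[], by simp [Good]⟩
      | cons x l ih =>
        intro h
        obtain ⟨l', hl'⟩ := ih fun q hq => h q (List.mem_cons_of_mem _ hq)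
        obtain ⟨k, hk⟩ := h x List.mem_cons_self
        obtain ⟨l1, h1, h2, h3, -⟩ := gen k x (hA k x hk) 1 (one_mem _)
        have := Good.append (A := A) ⟨fun q hq => ⟨k, h1 q hq⟩, h2, h3⟩ hl'
        rw [one_mul] at this
        exact ⟨_, by simpa using this⟩
    obtain ⟨l, hl, hl'⟩ := top (a * b⁻¹)
    obtain ⟨l', h⟩ := aux l hl
    obtain ⟨l2, h2, -⟩ := diag b
    have := h.append h2
    rw [hl'] at this
    simp at this
    exact ⟨_, this⟩
  have exc : ∀ a b : G, ∃ r : ℝ, (∃ q : ℚ, r = q) ∧ (∃ l, Good A l a b ∧ cost ℓ l = r) ∧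
      ∀ l, Good A l a b → r ≤ cost ℓ l := by
    intro a b
    have hne : ∃ n : ℕ, ∃ l, Good A l a b ∧ cost ℓ l * M = n := by
      obtain ⟨l, hl⟩ := ex a b
      obtain ⟨n, hn⟩ := hcost l hl.1
      exact ⟨n, l, hl, hn⟩
    obtain ⟨l, hl, hn⟩ := Nat.find_spec hne
    refine ⟨cost ℓ l, ⟨(Nat.find hne : ℚ) / M, ?_⟩, ⟨l, hl, rfl⟩, ?_⟩
    · push_cast
      rw [← hn]; field_simp
    · intro l' hl'
      obtain ⟨n', hn'⟩ := hcost l' hl'.1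
      have h1 := Nat.find_min' hne ⟨l', hl', hn'⟩
      have h2 : ((Nat.find hne : ℕ) : ℝ) ≤ n' := by exact_mod_cast h1
      rw [← hn, ← hn'] at h2
      exact le_of_mul_le_mul_right h2 hMr
  choose c hcq hcl hcm using exc
  have c0 : ∀ a b, 0 ≤ c a b := by
    intro a b
    obtain ⟨l, hl, h⟩ := hcl a b
    rw [← h]; exact cost_nonneg hl nnA
  have caa : ∀ a, c a a = 0 := by
    intro a
    obtain ⟨l, hl, h⟩ := diag a
    exact le_antisymm (h ▸ hcm a a l hl) (c0 _ _)
  have ceq : ∀ a b, c a b = 0 → a = b := by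
    intro a b h
    obtain ⟨l, ⟨hl, h1, h2⟩, hc⟩ := hcl a b
    rw [h] at hc
    have : ∀ q ∈ l, q.1 = q.2 := by
      intro q hq
      obtain ⟨k, hk1, hk2⟩ := hl q hq
      have hz : ℓ (q.1⁻¹ * q.2) = 0 := by
        refine le_antisymm ?_ (nnA k _ hk1 _ hk2)
        rw [← hc]
        apply List.single_le_sum
        · intro x hx
          obtain ⟨q', hq', rfl⟩ := List.mem_map.1 hx
          obtain ⟨k', h1', h2'⟩ := hl q' hq'
          exact nnA k' _ h1' _ h2'
        · exact List.mem_map.2 ⟨q, hq, rfl⟩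
      exact inv_mul_eq_one.1 (pos k _ (hHm k _ hk1 _ hk2) hz)
    rw [← h1, ← h2]
    congr 1
    exact List.map_congr_left this
  have csymm : ∀ a b, c a b ≤ c b a := by
    intro a b
    obtain ⟨l, ⟨hl, h1, h2⟩, hc⟩ := hcl b a
    have hg : Good A (l.map Prod.swap) a b := by
      refine ⟨?_, by simpa [Function.comp_def] using h2, by simpa [Function.comp_def] using h1⟩
      intro q hq
      obtain ⟨q', hq', rfl⟩ := List.mem_map.1 hq
      obtain ⟨k, hk⟩ := hl q' hq'
      exact ⟨k, hk.2, hk.1⟩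
    have hcc : cost ℓ (l.map Prod.swap) = cost ℓ l := by
      simp only [cost, List.map_map]
      congr 1
      apply List.map_congr_left
      intro q hq
      obtain ⟨k, hk1, hk2⟩ := hl q hq
      have := N.inv k _ (hHm k _ hk1 _ hk2)
      simpa using this
    rw [← hc, ← hcc]
    exact hcm a b _ hg
  have cmul : ∀ a b a' b', c (a * a') (b * b') ≤ c a b + c a' b' := by
    intro a b a' b'
    obtain ⟨l, hl, hc⟩ := hcl a b
    obtain ⟨l', hl', hc'⟩ := hcl a' b'
    rw [← hc, ← hc', ← cost_append]
    exact hcm _ _ _ (hl.append hl')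
  have ctri : ∀ x y z, c x z ≤ c x y + c y z := by
    intro x y z
    have h1 := cmul x y (y⁻¹ * y) (y⁻¹ * z)
    have h2 := cmul y⁻¹ y⁻¹ y z
    rw [caa] at h2
    simp only [inv_mul_cancel, mul_one, mul_inv_cancel_left] at h1 h2
    linarith
  have cleft : ∀ g x y, c (g * x) (g * y) ≤ c x y := by
    intro g x y
    have := cmul g g x y
    rwa [caa, zero_add] at this
  have cright : ∀ g x y, c (x * g) (y * g) ≤ c x y := by
    intro g x y
    have := cmul x y g g
    rwa [caa, add_zero] at this
  have hd : ∀ k, ∀ a ∈ H k, ∀ b ∈ H k, min (K : ℝ) (c a b) = ℓ (a⁻¹ * b) := by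
    intro k a ha b hb
    apply le_antisymm
    · obtain ⟨l, h1, h2, h3, h4⟩ := gen k a ha b hb
      rw [← h4]
      exact min_le_min le_rfl (hcm _ _ _ ⟨fun q hq => ⟨k, h1 q hq⟩, h2, h3⟩)
    · apply le_min (bd k _ (mul_mem (inv_mem ha) hb))
      obtain ⟨l, hl, hc⟩ := hcl a b
      rw [← hc]
      exact cor k a ha b hb l hl
  refine ⟨fun a b => min (K : ℝ) (c a b), ⟨⟨⟨?_, ?_, ?_⟩, ?_, ?_⟩, A true ∪ A false, ?_, ?_, ?_⟩,
    ?_, hd⟩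
  · intro x y
    constructor
    · intro h
      apply ceq
      rcases min_choice (K : ℝ) (c x y) with h' | h'
      · simp only [h'] at h; linarith
      · simpa only [h'] using h
    · rintro rfl
      simp [caa, hKr.le]
  · intro x y
    simp only [le_antisymm (csymm x y) (csymm y x)]
  · intro x y z
    exact (min_le_min le_rfl (ctri x y z)).trans (min_triangle _ _ _ hKr (c0 _ _) (c0 _ _))
  · intro g x y
    have h := cleft g⁻¹ (g * x) (g * y)
    simp only [inv_mul_cancel_left] at h
    simp only [le_antisymm (cleft g x y) h]
  · intro g x y
    have h := cright g⁻¹ (x * g) (y * g)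
    simp only [mul_inv_cancel_right] at h
    simp only [le_antisymm (cright g x y) h]
  · exact Finset.mem_union_left _ hA1
  · intro a ha
    rcases Finset.mem_union.1 ha with ha | ha
    · exact Finset.mem_union_left _ (hAi _ _ ha)
    · exact Finset.mem_union_right _ (hAi _ _ ha)
  · intro a b
    constructor
    · obtain ⟨l, ⟨hl, h1, h2⟩, hc⟩ := hcl a b
      refine ⟨l, ?_, h1, h2, ?_⟩
      · intro q hq
        obtain ⟨k, hk⟩ := hl q hq
        cases k <;> simp [hk]
      · change min (K : ℝ) (c a b) = _
        rw [← hc, cost]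
        congr 2
        apply List.map_congr_left
        intro q hq
        obtain ⟨k, hk1, hk2⟩ := hl q hq
        exact (hd k _ (hA k _ hk1) _ (hA k _ hk2)).symm
    · rintro s ⟨l, -, rfl, rfl, rfl⟩
      refine le_min (min_le_left _ _) ?_
      clear * - cmul caa c0 hKr
      induction l with
      | nil => simp [caa]
      | cons q l ih =>
        simp only [List.map_cons, List.prod_cons, List.sum_cons]
        exact (min_le_min le_rfl (cmul _ _ _ _)).trans
          ((min_triangle _ _ _ hKr (c0 _ _) (c0 _ _)).trans (by linarith))
  · intro a b
    obtain ⟨q, hq⟩ := hcq a b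
    exact ⟨min K q, by simp [hq]⟩

end
end Amalg

namespace Amalg

section
variable {S₀ S₁ S₂ : Type}

/-- first inclusion -/
abbrev i1 (S₀ S₁ S₂ : Type) : FreeGroup (S₀ ⊕ S₁) →* FreeGroup (S₀ ⊕ S₁ ⊕ S₂) :=
  FreeGroup.map (Sum.map id Sum.inl)

/-- second inclusion -/
abbrev i2 (S₀ S₁ S₂ : Type) : FreeGroup (S₀ ⊕ S₂) →* FreeGroup (S₀ ⊕ S₁ ⊕ S₂) :=
  FreeGroup.map (Sum.map id Sum.inr)

/-- first retraction -/
abbrev r1 (S₀ S₁ S₂ : Type) : FreeGroup (S₀ ⊕ S₁ ⊕ S₂) →* FreeGroup (S₀ ⊕ S₁) :=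
  FreeGroup.lift (Sum.elim (fun s => FreeGroup.of (Sum.inl s))
    (Sum.elim (fun s => FreeGroup.of (Sum.inr s)) fun _ => 1))

/-- second retraction -/
abbrev r2 (S₀ S₁ S₂ : Type) : FreeGroup (S₀ ⊕ S₁ ⊕ S₂) →* FreeGroup (S₀ ⊕ S₂) :=
  FreeGroup.lift (Sum.elim (fun s => FreeGroup.of (Sum.inl s))
    (Sum.elim (fun _ => 1) (fun s => FreeGroup.of (Sum.inr s))))

/-- retraction onto the common factor -/
abbrev r0 (S₀ S₂ : Type) : FreeGroup (S₀ ⊕ S₂) →* FreeGroup S₀ :=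
  FreeGroup.lift (Sum.elim (fun s => FreeGroup.of s) (fun _ => 1))

theorem r1_i1 (x : FreeGroup (S₀ ⊕ S₁)) : r1 S₀ S₁ S₂ (i1 S₀ S₁ S₂ x) = x := by
  have : (r1 S₀ S₁ S₂).comp (i1 S₀ S₁ S₂) = MonoidHom.id _ := by
    ext s; rcases s with s | s <;> simp
  exact DFunLike.congr_fun this x

theorem r2_i2 (x : FreeGroup (S₀ ⊕ S₂)) : r2 S₀ S₁ S₂ (i2 S₀ S₁ S₂ x) = x := by
  have : (r2 S₀ S₁ S₂).comp (i2 S₀ S₁ S₂) = MonoidHom.id _ := by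
    ext s; rcases s with s | s <;> simp
  exact DFunLike.congr_fun this x

theorem r1_i2 (x : FreeGroup (S₀ ⊕ S₂)) :
    r1 S₀ S₁ S₂ (i2 S₀ S₁ S₂ x) = FreeGroup.map Sum.inl (r0 S₀ S₂ x) := by
  have : (r1 S₀ S₁ S₂).comp (i2 S₀ S₁ S₂) = (FreeGroup.map Sum.inl).comp (r0 S₀ S₂) := by
    ext s; rcases s with s | s <;> simp
  exact DFunLike.congr_fun this x

theorem i1_inl (x : FreeGroup S₀) :
    i1 S₀ S₁ S₂ (FreeGroup.map Sum.inl x) = FreeGroup.map Sum.inl x := by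
  have : (i1 S₀ S₁ S₂).comp (FreeGroup.map Sum.inl) = FreeGroup.map Sum.inl := by
    ext s; simp
  exact DFunLike.congr_fun this x

theorem i2_inl (x : FreeGroup S₀) :
    i2 S₀ S₁ S₂ (FreeGroup.map Sum.inl x) = FreeGroup.map Sum.inl x := by
  have : (i2 S₀ S₁ S₂).comp (FreeGroup.map Sum.inl) = FreeGroup.map Sum.inl := by
    ext s; simp
  exact DFunLike.congr_fun this x

theorem meet {x : FreeGroup (S₀ ⊕ S₁)} {z : FreeGroup (S₀ ⊕ S₂)}
    (h : i1 S₀ S₁ S₂ x = i2 S₀ S₁ S₂ z) :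
    ∃ a : FreeGroup S₀, x = FreeGroup.map Sum.inl a ∧ z = FreeGroup.map Sum.inl a := by
  have hx : x = FreeGroup.map Sum.inl (r0 S₀ S₂ z) := by
    rw [← r1_i2 (S₁ := S₁), ← h, r1_i1]
  refine ⟨r0 S₀ S₂ z, hx, ?_⟩
  have h2 : r2 S₀ S₁ S₂ (i2 S₀ S₁ S₂ z) =
      r2 S₀ S₁ S₂ (i2 S₀ S₁ S₂ (FreeGroup.map Sum.inl (r0 S₀ S₂ z))) := by
    rw [i2_inl, ← i1_inl, ← hx, h]
  rwa [r2_i2, r2_i2] at h2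

theorem univ_free {Q : Type} [Monoid Q] (f1 : FreeGroup (S₀ ⊕ S₁) →* Q)
    (f2 : FreeGroup (S₀ ⊕ S₂) →* Q)
    (h : ∀ a : FreeGroup S₀, f1 (FreeGroup.map Sum.inl a) = f2 (FreeGroup.map Sum.inl a)) :
    ∃ J : FreeGroup (S₀ ⊕ S₁ ⊕ S₂) →* Q, (∀ x, J (i1 S₀ S₁ S₂ x) = f1 x) ∧
      ∀ x, J (i2 S₀ S₁ S₂ x) = f2 x := by
  let g1 := f1.toHomUnits
  let g2 := f2.toHomUnits
  let J : FreeGroup (S₀ ⊕ S₁ ⊕ S₂) →* Qˣ := FreeGroup.lift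
    (Sum.elim (fun s => g1 (FreeGroup.of (Sum.inl s)))
      (Sum.elim (fun s => g1 (FreeGroup.of (Sum.inr s))) fun s => g2 (FreeGroup.of (Sum.inr s))))
  refine ⟨(Units.coeHom Q).comp J, ?_, ?_⟩
  · intro x
    have : J.comp (i1 S₀ S₁ S₂) = g1 := by
      ext s; rcases s with s | s <;> simp [J]
    have := DFunLike.congr_fun this x
    exact congrArg Units.val this
  · intro x
    have : J.comp (i2 S₀ S₁ S₂) = g2 := by
      apply FreeGroup.ext_hom
      intro s; rcases s with s | s
      · simp only [MonoidHom.comp_apply, FreeGroup.map.of, Sum.map_inl, id, J,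
          FreeGroup.lift_apply_of, Sum.elim_inl]
        apply Units.ext
        have := h (FreeGroup.of s)
        simpa [g1, g2] using this
      · simp [J]
    have := DFunLike.congr_fun this x
    exact congrArg Units.val this

end

theorem min_nn {G : Type} {d : G → G → ℝ} (h : IsMetricFun d) (x y : G) : 0 ≤ d x y := by
  have h1 := h.2.2 x y x
  rw [(h.1 x x).2 rfl, h.2.1 y x] at h1
  linarith

/-- facts on a single metric -/
theorem biinv_facts {G : Type} [Group G] {d : G → G → ℝ} (h : IsBiInvMetric d) :
    d 1 1 = 0 ∧ (∀ x y, d (x * y) 1 ≤ d x 1 + d y 1) ∧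
    (∀ x y, d (y⁻¹ * x * y) 1 = d x 1) ∧ (∀ x, d x⁻¹ 1 = d x 1) ∧
    (∀ x, 0 ≤ d x 1) ∧ (∀ x, d x 1 = 0 → x = 1) ∧ ∀ x y, d (x⁻¹ * y) 1 = d x y := by
  obtain ⟨hm, hl, hr⟩ := h
  have e : ∀ x y, d (x⁻¹ * y) 1 = d x y := by
    intro x y
    have := hl x (x⁻¹ * y) 1
    rw [mul_inv_cancel_left, mul_one] at this
    rw [← this, hm.2.1]
  refine ⟨(hm.1 _ _).2 rfl, ?_, ?_, ?_, fun x => min_nn hm _ _, fun x => (hm.1 _ _).1, e⟩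
  · intro x y
    have h1 := hm.2.2 (x * y) y 1
    have h2 := hr y x 1
    rw [one_mul] at h2
    linarith
  · intro x y
    rw [mul_assoc, e]
    have := hr y x 1
    rw [one_mul] at this
    rw [← this, hm.2.1]
  · intro x
    have := e x 1
    rw [mul_one] at this
    rw [this, ← hm.2.1, hm.2.1]

end Amalg

/-- **amalgamation.** Let `K > 0` be rational and `S₀, S₁, S₂` finite (pairwise
disjoint) sets.  If `d₁`, `d₂` are finitely generated rational metrics bounded by `K` on the
free groups `F(S₀ ⊕ S₁)` and `F(S₀ ⊕ S₂)` whose restrictions to the common free factor `F(S₀)`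
coincide with a finitely generated rational `K`-bounded metric `d₀` (the inclusions being
isometric), then there is a finitely generated rational metric `d₃` bounded by `K` on
`F(S₀ ⊕ S₁ ⊕ S₂)` for which both canonical inclusions (sending free generators to free
generators) are isometric group monomorphisms. -/
theorem fin_gen_rational_metrics_amalgamation (K : ℚ) (hK : 0 < K)
    (S₀ S₁ S₂ : Type) [Finite S₀] [Finite S₁] [Finite S₂]
    (d₀ : FreeGroup S₀ → FreeGroup S₀ → ℝ)
    (d₁ : FreeGroup (S₀ ⊕ S₁) → FreeGroup (S₀ ⊕ S₁) → ℝ)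
    (d₂ : FreeGroup (S₀ ⊕ S₂) → FreeGroup (S₀ ⊕ S₂) → ℝ)
    (h₀ : IsFinGenMetricBdd (K : ℝ) d₀) (hq₀ : ∀ a b, ∃ q : ℚ, d₀ a b = (q : ℝ))
    (h₁ : IsFinGenMetricBdd (K : ℝ) d₁) (hq₁ : ∀ a b, ∃ q : ℚ, d₁ a b = (q : ℝ))
    (h₂ : IsFinGenMetricBdd (K : ℝ) d₂) (hq₂ : ∀ a b, ∃ q : ℚ, d₂ a b = (q : ℝ))
    (hiso₁ : ∀ a b : FreeGroup S₀,
      d₁ (FreeGroup.map Sum.inl a) (FreeGroup.map Sum.inl b) = d₀ a b)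
    (hiso₂ : ∀ a b : FreeGroup S₀,
      d₂ (FreeGroup.map Sum.inl a) (FreeGroup.map Sum.inl b) = d₀ a b) :
    ∃ d₃ : FreeGroup (S₀ ⊕ S₁ ⊕ S₂) → FreeGroup (S₀ ⊕ S₁ ⊕ S₂) → ℝ,
      IsFinGenMetricBdd (K : ℝ) d₃ ∧ (∀ a b, ∃ q : ℚ, d₃ a b = (q : ℝ)) ∧
      (∀ a b : FreeGroup (S₀ ⊕ S₁),
        d₃ (FreeGroup.map (Sum.map id Sum.inl) a) (FreeGroup.map (Sum.map id Sum.inl) b) =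
          d₁ a b) ∧
      ∀ a b : FreeGroup (S₀ ⊕ S₂),
        d₃ (FreeGroup.map (Sum.map id Sum.inr) a) (FreeGroup.map (Sum.map id Sum.inr) b) =
          d₂ a b := by
  
  classical
  obtain ⟨b₁, A₁, hA₁1, hA₁i, hA₁⟩ := h₁
  obtain ⟨b₂, A₂, hA₂1, hA₂i, hA₂⟩ := h₂
  obtain ⟨o₁, m₁, c₁, v₁, n₁, p₁, e₁⟩ := Amalg.biinv_facts b₁
  obtain ⟨o₂, m₂, c₂, v₂, n₂, p₂, e₂⟩ := Amalg.biinv_facts b₂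
  let ι₁ := Amalg.i1 S₀ S₁ S₂
  let ι₂ := Amalg.i2 S₀ S₁ S₂
  let ι₀ : FreeGroup S₀ →* FreeGroup (S₀ ⊕ S₁ ⊕ S₂) := FreeGroup.map Sum.inl
  have inj₁ : Function.Injective ι₁ := Function.LeftInverse.injective Amalg.r1_i1
  have inj₂ : Function.Injective ι₂ := Function.LeftInverse.injective Amalg.r2_i2
  have i10 : ∀ a, ι₁ (FreeGroup.map Sum.inl a) = ι₀ a := Amalg.i1_inl
  have i20 : ∀ a, ι₂ (FreeGroup.map Sum.inl a) = ι₀ a := Amalg.i2_inl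
  let H : Bool → Subgroup (FreeGroup (S₀ ⊕ S₁ ⊕ S₂)) := fun b => if b then ι₁.range else ι₂.range
  let ℓ : FreeGroup (S₀ ⊕ S₁ ⊕ S₂) → ℝ := fun g =>
    if h : ∃ x, ι₁ x = g then d₁ h.choose 1 else if h : ∃ x, ι₂ x = g then d₂ h.choose 1 else 0
  have hℓ₁ : ∀ x, ℓ (ι₁ x) = d₁ x 1 := by
    intro x
    have h : ∃ y, ι₁ y = ι₁ x := ⟨x, rfl⟩
    simp only [ℓ, dif_pos h]
    rw [inj₁ h.choose_spec]
  have hℓ₂ : ∀ x, ℓ (ι₂ x) = d₂ x 1 := by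
    intro z
    by_cases h : ∃ y, ι₁ y = ι₂ z
    · obtain ⟨x, hx⟩ := h
      obtain ⟨a, rfl, rfl⟩ := Amalg.meet hx
      rw [← hx, hℓ₁]
      have h1 := hiso₁ a 1
      have h2 := hiso₂ a 1
      rw [map_one] at h1 h2
      rw [h1, h2]
    · have h' : ∃ y, ι₂ y = ι₂ z := ⟨z, rfl⟩
      simp only [ℓ, dif_neg h, dif_pos h']
      rw [inj₂ h'.choose_spec]
  have N : Amalg.Nrm H ι₀.range ℓ := by
    refine ⟨?_, ?_, ?_, ?_, ?_⟩
    · rintro (_ | _)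
      · rintro _ ⟨a, rfl⟩; exact ⟨_, i20 a⟩
      · rintro _ ⟨a, rfl⟩; exact ⟨_, i10 a⟩
    · rw [← map_one ι₁, hℓ₁, o₁]
    · rintro (_ | _)
      · rintro _ ⟨x, rfl⟩ _ ⟨y, rfl⟩
        rw [← map_mul, hℓ₂, hℓ₂, hℓ₂]; exact m₂ x y
      · rintro _ ⟨x, rfl⟩ _ ⟨y, rfl⟩
        rw [← map_mul, hℓ₁, hℓ₁, hℓ₁]; exact m₁ x y
    · rintro (_ | _)
      · rintro _ ⟨x, rfl⟩ _ ⟨y, rfl⟩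
        rw [← map_inv, ← map_mul, ← map_mul, hℓ₂, hℓ₂]; exact c₂ x y
      · rintro _ ⟨x, rfl⟩ _ ⟨y, rfl⟩
        rw [← map_inv, ← map_mul, ← map_mul, hℓ₁, hℓ₁]; exact c₁ x y
    · rintro (_ | _)
      · rintro _ ⟨x, rfl⟩
        rw [← map_inv, hℓ₂, hℓ₂]; exact v₂ x
      · rintro _ ⟨x, rfl⟩
        rw [← map_inv, hℓ₁, hℓ₁]; exact v₁ x
  have bd₁ : ∀ x y, d₁ x y ≤ K := by
    intro x y
    obtain ⟨l, -, -, -, h⟩ := (hA₁ x y).1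
    rw [h]; exact min_le_left _ _
  have bd₂ : ∀ x y, d₂ x y ≤ K := by
    intro x y
    obtain ⟨l, -, -, -, h⟩ := (hA₂ x y).1
    rw [h]; exact min_le_left _ _
  let A : Bool → Finset (FreeGroup (S₀ ⊕ S₁ ⊕ S₂)) := fun b => if b then A₁.image ι₁ else A₂.image ι₂
  have hA : ∀ k, ∀ x ∈ A k, x ∈ H k := by
    rintro (_ | _) x hx
    · obtain ⟨y, -, rfl⟩ := Finset.mem_image.1 hx
      exact ⟨y, rfl⟩
    · obtain ⟨y, -, rfl⟩ := Finset.mem_image.1 hx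
      exact ⟨y, rfl⟩
  have gen : ∀ k, ∀ a ∈ H k, ∀ b ∈ H k, ∃ l : List (FreeGroup (S₀ ⊕ S₁ ⊕ S₂) × FreeGroup (S₀ ⊕ S₁ ⊕ S₂)),
      (∀ q ∈ l, q.1 ∈ A k ∧ q.2 ∈ A k) ∧
      (l.map Prod.fst).prod = a ∧ (l.map Prod.snd).prod = b ∧
      min (K : ℝ) (Amalg.cost ℓ l) = ℓ (a⁻¹ * b) := by
    rintro (_ | _)
    · rintro _ ⟨x, rfl⟩ _ ⟨y, rfl⟩
      obtain ⟨l, hl, h1, h2, h3⟩ := (hA₂ x y).1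
      refine ⟨l.map (Prod.map ι₂ ι₂), ?_, ?_, ?_, ?_⟩
      · intro q hq
        obtain ⟨q', hq', rfl⟩ := List.mem_map.1 hq
        exact ⟨Finset.mem_image_of_mem _ (hl q' hq').1, Finset.mem_image_of_mem _ (hl q' hq').2⟩
      · rw [← h1, map_list_prod]; simp [Function.comp_def]
      · rw [← h2, map_list_prod]; simp [Function.comp_def]
      · rw [← map_inv, ← map_mul, hℓ₂, e₂, h3]
        simp only [Amalg.cost, List.map_map, Function.comp_def, Prod.map]
        simp only [← map_inv, ← map_mul, hℓ₂, e₂]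
    · rintro _ ⟨x, rfl⟩ _ ⟨y, rfl⟩
      obtain ⟨l, hl, h1, h2, h3⟩ := (hA₁ x y).1
      refine ⟨l.map (Prod.map ι₁ ι₁), ?_, ?_, ?_, ?_⟩
      · intro q hq
        obtain ⟨q', hq', rfl⟩ := List.mem_map.1 hq
        exact ⟨Finset.mem_image_of_mem _ (hl q' hq').1, Finset.mem_image_of_mem _ (hl q' hq').2⟩
      · rw [← h1, map_list_prod]; simp [Function.comp_def]
      · rw [← h2, map_list_prod]; simp [Function.comp_def]
      · rw [← map_inv, ← map_mul, hℓ₁, e₁, h3]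
        simp only [Amalg.cost, List.map_map, Function.comp_def, Prod.map]
        simp only [← map_inv, ← map_mul, hℓ₁, e₁]
  have univ : ∀ (Q : Type) [Monoid Q] (j1 : H true →* Q) (j2 : H false →* Q),
      (∀ a (ha : a ∈ ι₀.range), j1 ⟨a, N.le _ ha⟩ = j2 ⟨a, N.le _ ha⟩) →
      ∃ J : FreeGroup (S₀ ⊕ S₁ ⊕ S₂) →* Q, (∀ x : H true, J x = j1 x) ∧ ∀ x : H false, J x = j2 x := by
    intro Q _ j1 j2 h
    obtain ⟨J, hJ1, hJ2⟩ := Amalg.univ_free (S₀ := S₀) (S₁ := S₁) (S₂ := S₂)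
      (j1.comp ι₁.rangeRestrict) (j2.comp ι₂.rangeRestrict) (by
        intro a
        have := h (ι₀ a) ⟨a, rfl⟩
        have e1 : ι₁.rangeRestrict (FreeGroup.map Sum.inl a) =
          (⟨ι₀ a, N.le true ⟨a, rfl⟩⟩ : H true) := Subtype.ext (i10 a)
        have e2 : ι₂.rangeRestrict (FreeGroup.map Sum.inl a) =
          (⟨ι₀ a, N.le false ⟨a, rfl⟩⟩ : H false) := Subtype.ext (i20 a)
        change j1 (ι₁.rangeRestrict _) = j2 (ι₂.rangeRestrict _)
        rw [e1, e2]; exact this)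
    refine ⟨J, ?_, ?_⟩
    · rintro ⟨_, ⟨x, rfl⟩⟩; exact hJ1 x
    · rintro ⟨_, ⟨x, rfl⟩⟩; exact hJ2 x
  have cor : ∀ k, ∀ a ∈ H k, ∀ b ∈ H k, ∀ l : List (FreeGroup (S₀ ⊕ S₁ ⊕ S₂) × FreeGroup (S₀ ⊕ S₁ ⊕ S₂)), Amalg.Good A l a b →
      ℓ (a⁻¹ * b) ≤ Amalg.cost ℓ l := by
    intro k a ha b hb l hl
    obtain ⟨hl, h1, h2⟩ := hl
    have hcost : Amalg.cost ℓ ((a⁻¹, a⁻¹) :: l) = Amalg.cost ℓ l := by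
      simp [Amalg.cost, N.one]
    have hg : ∀ q ∈ (a⁻¹, a⁻¹) :: l, ∃ k, q.1 ∈ H k ∧ q.2 ∈ H k := by
      intro q hq
      rcases List.mem_cons.1 hq with rfl | hq
      · exact ⟨k, inv_mem ha, inv_mem ha⟩
      · obtain ⟨k', hk'⟩ := hl q hq
        exact ⟨k', hA _ _ hk'.1, hA _ _ hk'.2⟩
    rw [← hcost]
    have q1 : (((a⁻¹, a⁻¹) :: l).map Prod.fst).prod = 1 := by simp [h1]
    have q2 : (((a⁻¹, a⁻¹) :: l).map Prod.snd).prod = a⁻¹ * b := by simp [h2]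
    cases k with
    | true => exact Amalg.core N univ _ hg (a⁻¹ * b) (mul_mem (inv_mem ha) hb) q1 q2
    | false =>
      have N' : Amalg.Nrm (fun b => H (!b)) ι₀.range ℓ :=
        ⟨fun k => N.le _, N.one, fun k => N.mul _, fun k => N.conj _, fun k => N.inv _⟩
      refine Amalg.core N' ?_ _ (fun q hq => ?_) (a⁻¹ * b) (mul_mem (inv_mem ha) hb) q1 q2
      · intro Q _ j1 j2 h
        obtain ⟨J, hJ1, hJ2⟩ := univ Q j2 j1 fun a ha => (h a ha).symm
        exact ⟨J, hJ2, hJ1⟩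
      · obtain ⟨k, hk⟩ := hg q hq
        exact ⟨!k, by simpa using hk⟩
  have top : ∀ g : FreeGroup (S₀ ⊕ S₁ ⊕ S₂), ∃ l : List (FreeGroup (S₀ ⊕ S₁ ⊕ S₂)), (∀ x ∈ l, ∃ k, x ∈ A k) ∧ l.prod = g := by
    have hH : ∀ k, ∀ a ∈ H k, ∃ l : List (FreeGroup (S₀ ⊕ S₁ ⊕ S₂)), (∀ x ∈ l, ∃ k, x ∈ A k) ∧ l.prod = a := by
      intro k a ha
      obtain ⟨l, hl, h, -⟩ := gen k a ha a ha
      refine ⟨l.map Prod.fst, ?_, h⟩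
      intro x hx
      obtain ⟨q, hq, rfl⟩ := List.mem_map.1 hx
      exact ⟨k, (hl q hq).1⟩
    have hof : ∀ s, ∃ k, (FreeGroup.of s : FreeGroup (S₀ ⊕ S₁ ⊕ S₂)) ∈ H k := by
      rintro (s | s | s)
      · exact ⟨true, FreeGroup.of (Sum.inl s), by simp [ι₁]⟩
      · exact ⟨true, FreeGroup.of (Sum.inr s), by simp [ι₁]⟩
      · exact ⟨false, FreeGroup.of (Sum.inr s), by simp [ι₂]⟩
    intro g
    induction g using FreeGroup.induction_on with
    | C1 => exact ⟨[], by simp⟩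
    | of s => obtain ⟨k, hk⟩ := hof s; exact hH k _ hk
    | inv_of s _ => obtain ⟨k, hk⟩ := hof s; exact hH k _ (inv_mem hk)
    | mul x y hx hy =>
      obtain ⟨l, hl, rfl⟩ := hx
      obtain ⟨l', hl', rfl⟩ := hy
      refine ⟨l ++ l', ?_, by simp⟩
      intro x hx
      rcases List.mem_append.1 hx with hx | hx
      · exact hl x hx
      · exact hl' x hx
  obtain ⟨d, hd1, hd2, hd3⟩ := Amalg.amalg_metric (H := H) (H0 := ι₀.range) (ℓ := ℓ) K hK N
    (by rintro (_ | _) _ ⟨x, rfl⟩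
        · rw [hℓ₂]; exact n₂ x
        · rw [hℓ₁]; exact n₁ x)
    (by rintro (_ | _) _ ⟨x, rfl⟩ h
        · rw [hℓ₂] at h; rw [p₂ x h, map_one]
        · rw [hℓ₁] at h; rw [p₁ x h, map_one])
    (by rintro (_ | _) _ ⟨x, rfl⟩
        · rw [hℓ₂]; exact bd₂ x 1
        · rw [hℓ₁]; exact bd₁ x 1)
    (by rintro (_ | _) _ ⟨x, rfl⟩
        · rw [hℓ₂]; exact hq₂ x 1
        · rw [hℓ₁]; exact hq₁ x 1)
    A hA (Finset.mem_image.2 ⟨1, hA₁1, map_one _⟩)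
    (by rintro (_ | _) x hx
        · obtain ⟨y, hy, rfl⟩ := Finset.mem_image.1 hx
          exact Finset.mem_image.2 ⟨y⁻¹, hA₂i y hy, map_inv _ _⟩
        · obtain ⟨y, hy, rfl⟩ := Finset.mem_image.1 hx
          exact Finset.mem_image.2 ⟨y⁻¹, hA₁i y hy, map_inv _ _⟩)
    gen top cor
  refine ⟨d, hd1, hd2, ?_, ?_⟩
  · intro a b
    have := hd3 true (ι₁ a) ⟨a, rfl⟩ (ι₁ b) ⟨b, rfl⟩
    rw [← map_inv, ← map_mul, hℓ₁, e₁] at this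
    exact this
  · intro a b
    have := hd3 false (ι₂ a) ⟨a, rfl⟩ (ι₂ b) ⟨b, rfl⟩
    rw [← map_inv, ← map_mul, hℓ₂, e₂] at this
    exact this
end
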